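/- arXiv:0706.3218 — 3 statements merged into one kernel-verified Lean document; each statement's English description precedes it below -/
import Mathlib

section
/- For every n ≥ 1, Thompson's group F has no pockets of depth greater than or equal to max{4n − 3, 2n + 1} with respect to the generating set X_n: for every g ∈ F there exists h ∈ F with d_n(g, h) ≤ max{4n − 3, 2n + 1} and l_n(h) > l_n(g). -/
/-- The defining relations of Thompson's group `F` in the infinite presentation
`⟨x_k, k ≥ 0 | x_i⁻¹ x_j x_i = x_{j+1} for i < j⟩`. -/
def thompsonRels : Set (FreeGroup ℕ) :=
  {w | ∃ i j : ℕ, i < j ∧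
    w = (FreeGroup.of i)⁻¹ * FreeGroup.of j * FreeGroup.of i * (FreeGroup.of (j + 1))⁻¹}

/-- Thompson's group `F`. -/
abbrev ThompsonF := PresentedGroup thompsonRels

/-- The standard infinite family of generators `x_i` of Thompson's group `F`. -/
def x (i : ℕ) : ThompsonF := PresentedGroup.of i

/-- The word length of `g` with respect to a generating set `S`:
the least `m` such that `g` is a product of `m` elements of `S ∪ S⁻¹`. -/
noncomputable def wordLength {G : Type*} [Group G] (S : Set G) (g : G) : ℕ :=
  sInf {m | ∃ l : List G, l.length = m ∧ (∀ a ∈ l, a ∈ S ∨ a⁻¹ ∈ S) ∧ l.prod = g}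

/-- The consecutive generating set `X_n = {x_0, x_1, …, x_n}`. -/
def Xset (n : ℕ) : Set ThompsonF := {g | ∃ i ≤ n, g = x i}

/-- `l_n(g)`: word length of `g` with respect to `X_n`. -/
noncomputable def ln (n : ℕ) (g : ThompsonF) : ℕ := wordLength (Xset n) g

/-- `l_∞(g)`: word length of `g` with respect to the infinite generating set `{x_i | i ≥ 0}`. -/
noncomputable def linf (g : ThompsonF) : ℕ := wordLength (Set.range x) g

/-- The word metric `d_n(g,h) = l_n(g⁻¹ h)`. -/
noncomputable def dn (n : ℕ) (g h : ThompsonF) : ℕ := ln n (g⁻¹ * h)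

open scoped List

/-- The `i`-th generator of Thompson's group acting on the rational line. -/
def pieceMap (i : ℕ) (t : ℚ) : ℚ :=
  if t ≤ i then t else if t ≤ i + 2 then i + (t - i) / 2 else t - 1

/-- The inverse of `pieceMap i`. -/
def pieceInv (i : ℕ) (t : ℚ) : ℚ :=
  if t ≤ i then t else if t ≤ i + 1 then i + 2 * (t - i) else t + 1

/-- `pieceMap i` as a permutation of `ℚ`. -/
def piecePerm (i : ℕ) : Equiv.Perm ℚ where
  toFun := pieceMap i
  invFun := pieceInv i
  left_inv t := by
    unfold pieceMap pieceInv
    split_ifs <;> linarith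
  right_inv t := by
    unfold pieceMap pieceInv
    split_ifs <;> linarith

theorem piecePerm_rel {i j : ℕ} (h : i < j) :
    piecePerm j * piecePerm i = piecePerm i * piecePerm (j + 1) := by
  ext t
  have h' : (i : ℚ) + 1 ≤ j := by exact_mod_cast h
  simp only [Equiv.Perm.mul_apply, piecePerm, Equiv.coe_fn_mk, pieceMap]
  push_cast
  split_ifs <;> linarith

/-- The action of Thompson's group on the rational line. -/
def lineAction : ThompsonF →* Equiv.Perm ℚ :=
  PresentedGroup.toGroup (f := piecePerm) (by
    rintro _ ⟨i, j, h, rfl⟩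
    simp only [map_mul, map_inv, FreeGroup.lift_apply_of]
    rw [mul_assoc _ _ (piecePerm i), piecePerm_rel h]
    group)

theorem lineAction_x (i : ℕ) (t : ℚ) : lineAction (x i) t = pieceMap i t := by
  simp [lineAction, x, piecePerm]

theorem x_comm {i j : ℕ} (h : i < j) : x j * x i = x i * x (j + 1) := by
  have : (PresentedGroup.mk thompsonRels)
      ((FreeGroup.of i)⁻¹ * FreeGroup.of j * FreeGroup.of i * (FreeGroup.of (j + 1))⁻¹) = 1 :=
    PresentedGroup.one_of_mem ⟨i, j, h, rfl⟩
  simp only [map_mul, map_inv] at this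
  have h2 : (x i)⁻¹ * x j * x i * (x (j + 1))⁻¹ = 1 := this
  rw [mul_inv_eq_one] at h2
  rw [← h2]
  group

/-! ### Forests as lists of gaps

A binary forest on the leaves `0, 1, 2, …` is recorded by the list of the gaps (gap `k` lies
between the leaves `k` and `k + 1`) closed by a caret, the most recently closed gap first. -/

/-- The number of open gaps to the left of gap `k`. -/
def gapIdx (l : List ℕ) (k : ℕ) : ℕ := ((Finset.range k).filter (· ∉ l)).card

/-- Open the gap `k` if it is closed, and close it if it is open. -/
def toggle (l : List ℕ) (k : ℕ) : List ℕ := if k ∈ l then l.filter (· ≠ k) else k :: l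

/-- `u` lies strictly between `a` and `b`. -/
def Between (a b u : ℕ) : Prop := (a < u ∧ u < b) ∨ (b < u ∧ u < a)

/-- The gap `k` is separated by an open gap from every gap that was closed after it: if `k` is
closed, it is the root of its tree. -/
def Exposed (l : List ℕ) (k : ℕ) : Prop := ∀ a, [a, k] <+ l → ∃ u, u ∉ l ∧ Between a k u

/-- The state reached from `l` by toggling the gaps in `w` successively. -/
def exec (l w : List ℕ) : List ℕ := w.foldl toggle l

/-- Toggling the gaps in `w` from the state `l` is a legal path using only the generators
`x 0, …, x n`. -/
def Run (n : ℕ) : List ℕ → List ℕ → Prop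
  | _, [] => True
  | l, k :: w => Exposed l k ∧ gapIdx l k ≤ n ∧ Run n (toggle l k) w

/-- The generators used by a path, in order, with a flag for inverses. -/
def letters : List ℕ → List ℕ → List (ℕ × Bool)
  | _, [] => []
  | l, k :: w => (gapIdx l k, decide (k ∈ l)) :: letters (toggle l k) w

/-- The group element of a letter. -/
def letterVal (p : ℕ × Bool) : ThompsonF := if p.2 then (x p.1)⁻¹ else x p.1

/-- The positive element of `ThompsonF` given by a forest. -/
def phi : List ℕ → ThompsonF
  | [] => 1
  | k :: l => x (gapIdx l k) * phi l

theorem exec_cons (l : List ℕ) (k : ℕ) (w : List ℕ) : exec l (k :: w) = exec (toggle l k) w := rfl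

theorem exec_append (l w v : List ℕ) : exec l (w ++ v) = exec (exec l w) v := by
  simp [exec]

theorem run_append {n : ℕ} {l w v : List ℕ} :
    Run n l (w ++ v) ↔ Run n l w ∧ Run n (exec l w) v := by
  induction w generalizing l with
  | nil => simp [Run, exec]
  | cons k w ih => simp [Run, exec_cons, ih, and_assoc]

theorem letters_append (l w v : List ℕ) :
    letters l (w ++ v) = letters l w ++ letters (exec l w) v := by
  induction w generalizing l with
  | nil => simp [letters, exec]
  | cons k w ih => simp [letters, exec_cons, ih]

theorem length_letters (l w : List ℕ) : (letters l w).length = w.length := by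
  induction w generalizing l with
  | nil => rfl
  | cons k w ih => simp [letters, ih]

theorem run_of_letters_le {n N : ℕ} {l w : List ℕ} (h : Run N l w)
    (hn : ∀ p ∈ letters l w, p.1 ≤ n) : Run n l w := by
  induction w generalizing l with
  | nil => trivial
  | cons k w ih =>
    simp only [letters, List.mem_cons, forall_eq_or_imp] at hn
    exact ⟨h.1, hn.1, ih h.2.2 hn.2⟩

theorem letters_le {n : ℕ} {l w : List ℕ} (h : Run n l w) : ∀ p ∈ letters l w, p.1 ≤ n := by
  induction w generalizing l with
  | nil => simp [letters]
  | cons k w ih =>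
    simp only [letters, List.mem_cons, forall_eq_or_imp]
    exact ⟨h.2.1, ih h.2.2⟩

theorem mem_toggle {l : List ℕ} {k j : ℕ} :
    j ∈ toggle l k ↔ (j = k ∧ k ∉ l) ∨ (j ≠ k ∧ j ∈ l) := by
  unfold toggle
  split_ifs with h
  · simp [h]; tauto
  · by_cases hj : j = k <;> simp [h, hj]

theorem toggle_of_mem {l : List ℕ} {k : ℕ} (h : k ∈ l) : toggle l k = l.filter (· ≠ k) := if_pos h

theorem toggle_of_notMem {l : List ℕ} {k : ℕ} (h : k ∉ l) : toggle l k = k :: l := if_neg h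

theorem nodup_toggle {l : List ℕ} (hl : l.Nodup) (k : ℕ) : (toggle l k).Nodup := by
  unfold toggle
  split_ifs with h
  · exact hl.filter _
  · exact List.nodup_cons.2 ⟨h, hl⟩

theorem nodup_exec {l : List ℕ} (hl : l.Nodup) (w : List ℕ) : (exec l w).Nodup := by
  induction w generalizing l with
  | nil => exact hl
  | cons k w ih => exact ih (nodup_toggle hl k)

theorem mem_exec_of_notMem {l w : List ℕ} {k : ℕ} (h : k ∉ w) : k ∈ exec l w ↔ k ∈ l := by
  induction w generalizing l with
  | nil => rfl
  | cons j w ih =>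
    simp only [List.mem_cons, not_or] at h
    rw [exec_cons, ih h.2, mem_toggle]
    simp [h.1]

theorem pair_sublist_cons {a b k : ℕ} {l : List ℕ} :
    [a, b] <+ k :: l ↔ [a, b] <+ l ∨ (a = k ∧ b ∈ l) := by
  rw [List.sublist_cons_iff]
  simp only [List.cons.injEq]
  constructor
  · rintro (h | ⟨r, ⟨rfl, rfl⟩, h⟩)
    · exact Or.inl h
    · exact Or.inr ⟨rfl, by simpa using h⟩
  · rintro (h | ⟨rfl, h⟩)
    · exact Or.inl h
    · exact Or.inr ⟨[b], ⟨rfl, rfl⟩, by simpa using h⟩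

theorem pair_sublist_filter {a b : ℕ} {l : List ℕ} {p : ℕ → Bool} :
    [a, b] <+ l.filter p ↔ [a, b] <+ l ∧ p a ∧ p b := by
  constructor
  · intro h
    refine ⟨h.trans List.filter_sublist, ?_, ?_⟩
    · exact (List.mem_filter.1 (h.subset (by simp))).2
    · exact (List.mem_filter.1 (h.subset (by simp))).2
  · rintro ⟨h, ha, hb⟩
    simpa [ha, hb] using h.filter p

theorem pair_exec {l w : List ℕ} {a b : ℕ} (h : [a, b] <+ l) (ha : a ∉ w) (hb : b ∉ w) :
    [a, b] <+ exec l w := by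
  induction w generalizing l with
  | nil => exact h
  | cons k w ih =>
    simp only [List.mem_cons, not_or] at ha hb
    refine ih ?_ ha.2 hb.2
    unfold toggle
    split_ifs
    · rw [pair_sublist_filter]
      simp [h, ha.1, hb.1]
    · exact h.trans (List.sublist_cons_self _ _)

/-! ### Counting open gaps -/

theorem gapIdx_congr {l l' : List ℕ} {k : ℕ} (h : ∀ u < k, u ∈ l ↔ u ∈ l') :
    gapIdx l k = gapIdx l' k := by
  unfold gapIdx
  congr 1
  ext u
  simp only [Finset.mem_filter, Finset.mem_range]
  constructor <;> rintro ⟨h1, h2⟩ <;> refine ⟨h1, ?_⟩ <;> simpa [h u h1] using h2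

theorem gapIdx_succ (l : List ℕ) (k : ℕ) :
    gapIdx l (k + 1) = gapIdx l k + if k ∈ l then 0 else 1 := by
  unfold gapIdx
  rw [Finset.range_add_one, Finset.filter_insert]
  split_ifs <;> simp_all

theorem gapIdx_zero (l : List ℕ) : gapIdx l 0 = 0 := by simp [gapIdx]

theorem gapIdx_mono (l : List ℕ) : Monotone (gapIdx l) :=
  monotone_nat_of_le_succ fun k => by rw [gapIdx_succ]; omega

theorem gapIdx_lt {l : List ℕ} {a k : ℕ} (h : a < k) (ha : a ∉ l) :
    gapIdx l a + 1 ≤ gapIdx l k := by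
  have := gapIdx_mono l (Nat.succ_le_of_lt h)
  rw [Nat.succ_eq_add_one, gapIdx_succ, if_neg ha] at this
  exact this

theorem gapIdx_cons {l : List ℕ} {a k : ℕ} (ha : a ∉ l) :
    gapIdx l k = gapIdx (a :: l) k + if a < k then 1 else 0 := by
  induction k with
  | zero => simp [gapIdx_zero]
  | succ k ih =>
    rw [gapIdx_succ, gapIdx_succ, ih]
    rcases lt_trichotomy a k with h | rfl | h
    · have : k ≠ a := by omega
      simp [h, this, Nat.lt_succ_of_lt h]; omega
    · simp [ha]
    · have h1 : k ≠ a := by omega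
      have h2 : ¬ a < k := by omega
      have h3 : ¬ a < k + 1 := by omega
      simp [h1, h2, h3]

theorem gapIdx_anti {l l' : List ℕ} (h : l ⊆ l') (k : ℕ) : gapIdx l' k ≤ gapIdx l k := by
  unfold gapIdx
  apply Finset.card_le_card
  intro u
  simp only [Finset.mem_filter, Finset.mem_range]
  exact fun hu => ⟨hu.1, fun h' => hu.2 (h h')⟩

theorem gapIdx_toggle_self (l : List ℕ) (k : ℕ) : gapIdx (toggle l k) k = gapIdx l k :=
  gapIdx_congr fun u hu => by rw [mem_toggle]; simp [hu.ne]

theorem exists_gap (l : List ℕ) (i : ℕ) : ∃ k, k ∉ l ∧ gapIdx l k = i := by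
  have hex : ∃ k, i + 1 ≤ gapIdx l k := by
    have hb : ∀ k, k ≤ gapIdx l k + l.length := by
      intro k
      unfold gapIdx
      have h1 := Finset.card_filter_add_card_filter_not (s := Finset.range k) (fun u => u ∉ l)
      have h2 : ((Finset.range k).filter (fun u => ¬ u ∉ l)).card ≤ l.toFinset.card := by
        apply Finset.card_le_card
        intro u
        simp
      have h3 := l.toFinset_card_le
      rw [Finset.card_range] at h1
      omega
    exact ⟨i + 1 + l.length, by have := hb (i + 1 + l.length); omega⟩
  classical
  have hs := Nat.find_spec hex
  have h0 : Nat.find hex ≠ 0 := by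
    intro h
    rw [h, gapIdx_zero] at hs
    omega
  obtain ⟨k, hk⟩ := Nat.exists_eq_succ_of_ne_zero h0
  have hm := Nat.find_min hex (m := k) (by omega)
  rw [hk, Nat.succ_eq_add_one, gapIdx_succ] at hs
  refine ⟨k, ?_, ?_⟩
  · intro h
    simp [h] at hs
    omega
  · split_ifs at hs <;> omega

theorem open_gap_unique {l : List ℕ} {a b : ℕ} (ha : a ∉ l) (hb : b ∉ l)
    (h : gapIdx l a = gapIdx l b) : a = b := by
  rcases lt_trichotomy a b with h' | h' | h'
  · have := gapIdx_lt h' ha; omega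
  · exact h'
  · have := gapIdx_lt h' hb; omega

/-! ### Forests as positive elements -/

theorem exists_open_of_gapIdx_lt {l : List ℕ} {a b : ℕ} (h : gapIdx l a < gapIdx l b) :
    ∃ u, u ∉ l ∧ a ≤ u ∧ u < b := by
  by_contra hc
  push Not at hc
  have hab : a < b := by
    by_contra hab
    have := gapIdx_mono l (not_lt.1 hab)
    omega
  have key : ∀ d, a + d ≤ b → gapIdx l (a + d) = gapIdx l a := by
    intro d
    induction d with
    | zero => simp
    | succ d ih =>
      intro hd
      have hm : a + d ∈ l := by
        by_contra hm
        have := hc _ hm (by omega)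
        omega
      rw [← add_assoc, gapIdx_succ, if_pos hm, ih (by omega)]
      rfl
  have := key (b - a) (by omega)
  rw [Nat.add_sub_cancel' hab.le] at this
  omega

theorem gapIdx_le_of_closed {l : List ℕ} {a b : ℕ} (h : ∀ u, a ≤ u → u < b → u ∈ l) :
    gapIdx l b ≤ gapIdx l a := by
  by_contra hc
  obtain ⟨u, hu, h1, h2⟩ := exists_open_of_gapIdx_lt (not_le.1 hc)
  exact hu (h u h1 h2)

theorem filter_ne_of_notMem {l : List ℕ} {k : ℕ} (h : k ∉ l) : l.filter (· ≠ k) = l := by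
  rw [List.filter_eq_self]
  intro a ha
  simpa using fun hk : a = k => h (hk ▸ ha)

theorem phi_of_exposed {l : List ℕ} {k : ℕ} (hl : l.Nodup) (hk : k ∈ l) (ht : Exposed l k) :
    phi l = x (gapIdx l k) * phi (l.filter (· ≠ k)) := by
  induction l with
  | nil => simp at hk
  | cons a l ih =>
    rw [List.nodup_cons] at hl
    by_cases hak : k = a
    · subst hak
      have h2 : gapIdx (k :: l) k = gapIdx l k :=
        gapIdx_congr fun u hu => by simp [hu.ne]
      rw [List.filter_cons_of_neg (by simp), filter_ne_of_notMem hl.1, phi, h2]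
    · have hkl : k ∈ l := by simpa [hak] using hk
      have ih' := ih hl.2 hkl fun b hb => by
        obtain ⟨u, hu, hbu⟩ := ht b (hb.trans (List.sublist_cons_self _ _))
        exact ⟨u, fun h => hu (List.mem_cons_of_mem _ h), hbu⟩
      obtain ⟨u, hu, hau⟩ := ht a (by rw [pair_sublist_cons]; exact Or.inr ⟨rfl, hkl⟩)
      have hul : u ∉ l := fun h => hu (List.mem_cons_of_mem _ h)
      rw [List.filter_cons_of_pos (by simpa using Ne.symm hak), phi, phi, ih', ← mul_assoc,
        ← mul_assoc]
      congr 1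
      have hm : ∀ v, v ∈ k :: l.filter (· ≠ k) ↔ v ∈ l := by
        intro v
        by_cases hv : v = k <;> simp [hv, hkl]
      have hc : gapIdx (l.filter (· ≠ k)) a = gapIdx l a + if k < a then 1 else 0 := by
        rw [gapIdx_cons (a := k) (l := l.filter (· ≠ k)) (by simp),
          gapIdx_congr (l' := l) fun u _ => hm u]
      have hc' := gapIdx_cons (k := k) hl.1
      rcases hau with ⟨h1, h2⟩ | ⟨h1, h2⟩
      · have e1 := gapIdx_lt h2 hu
        have e2 := gapIdx_mono (a :: l) h1.le
        have e3 : gapIdx (a :: l) a = gapIdx l a := gapIdx_congr fun v hv => by simp [hv.ne]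
        rw [if_pos (by omega)] at hc'
        rw [if_neg (by omega), add_zero] at hc
        rw [hc, hc', ← x_comm (by omega)]
      · have e1 := gapIdx_lt h2 hul
        have e2 := gapIdx_mono l h1.le
        rw [if_neg (by omega), add_zero] at hc'
        rw [if_pos (by omega)] at hc
        rw [hc, ← hc', x_comm (by omega)]

theorem phi_toggle {l : List ℕ} {k : ℕ} (hl : l.Nodup) (ht : Exposed l k) :
    phi (toggle l k) = letterVal (gapIdx l k, decide (k ∈ l)) * phi l := by
  by_cases hk : k ∈ l
  · rw [toggle_of_mem hk, phi_of_exposed hl hk ht]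
    simp [letterVal, hk]
  · rw [toggle_of_notMem hk, phi]
    simp [letterVal, hk]

/-- The group element of a sequence of letters applied successively on the left. -/
def wordVal (c : List (ℕ × Bool)) : ThompsonF := (c.map letterVal).reverse.prod

theorem wordVal_cons (p : ℕ × Bool) (c : List (ℕ × Bool)) :
    wordVal (p :: c) = wordVal c * letterVal p := by
  simp [wordVal]

theorem wordVal_append (c d : List (ℕ × Bool)) : wordVal (c ++ d) = wordVal d * wordVal c := by
  simp [wordVal]

theorem phi_exec {n : ℕ} {l w : List ℕ} (hl : l.Nodup) (h : Run n l w) :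
    phi (exec l w) = wordVal (letters l w) * phi l := by
  induction w generalizing l with
  | nil => simp [exec, wordVal, letters]
  | cons k w ih =>
    rw [exec_cons, ih (nodup_toggle hl k) h.2.2, phi_toggle hl h.1, letters, wordVal_cons,
      mul_assoc]

theorem lineAction_phi_cons (k : ℕ) (l : List ℕ) (t : ℚ) :
    lineAction (phi (k :: l)) t = pieceMap (gapIdx l k) (lineAction (phi l) t) := by
  rw [phi, map_mul, Equiv.Perm.mul_apply, lineAction_x]

theorem lineAction_of_open {l : List ℕ} {k : ℕ} (hl : l.Nodup) (hk : k ∉ l) :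
    lineAction (phi l) (k + 1) = gapIdx l k + 1 := by
  induction l with
  | nil =>
    simp [phi, gapIdx]
  | cons a l ih =>
    rw [List.nodup_cons] at hl
    simp only [List.mem_cons, not_or] at hk
    rw [lineAction_phi_cons, ih hl.2 hk.2]
    have hc := gapIdx_cons (k := k) hl.1
    rcases lt_or_gt_of_ne hk.1 with h | h
    · rw [if_neg (by omega)] at hc
      have e : (gapIdx l k : ℚ) + 1 ≤ gapIdx l a := by exact_mod_cast gapIdx_lt h hk.2
      rw [add_zero] at hc
      rw [← hc, pieceMap, if_pos e]
    · rw [if_pos h] at hc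
      have hc' : (gapIdx l k : ℚ) = gapIdx (a :: l) k + 1 := by exact_mod_cast hc
      have e : (gapIdx l a : ℚ) + 1 ≤ gapIdx l k := by exact_mod_cast gapIdx_lt h hl.1
      unfold pieceMap
      split_ifs <;> linarith

theorem lineAction_of_closed {l : List ℕ} {k : ℕ} (hl : l.Nodup) (hk : k ∈ l) :
    (gapIdx l k : ℚ) < lineAction (phi l) (k + 1) ∧
      lineAction (phi l) (k + 1) < gapIdx l k + 1 := by
  induction l with
  | nil => simp at hk
  | cons a l ih =>
    rw [List.nodup_cons] at hl
    rw [lineAction_phi_cons]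
    have hc := gapIdx_cons (k := k) hl.1
    by_cases hka : k = a
    · subst hka
      rw [if_neg (by omega), add_zero] at hc
      rw [lineAction_of_open hl.2 hl.1, ← hc]
      unfold pieceMap
      split_ifs <;> constructor <;> linarith
    · obtain ⟨h1, h2⟩ := ih hl.2 (by simpa [hka] using hk)
      generalize lineAction (phi l) (k + 1) = t at *
      rcases lt_or_gt_of_ne hka with h | h
      · rw [if_neg (by omega), add_zero] at hc
        rw [← hc]
        rcases (gapIdx_mono l h.le).eq_or_lt with e | e
        · rw [← e]
          unfold pieceMap
          split_ifs <;> constructor <;> linarith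
        · have e' : (gapIdx l k : ℚ) + 1 ≤ gapIdx l a := by exact_mod_cast e
          rw [pieceMap, if_pos (by linarith)]
          exact ⟨h1, h2⟩
      · rw [if_pos h] at hc
        have hc' : (gapIdx l k : ℚ) = gapIdx (a :: l) k + 1 := by exact_mod_cast hc
        rcases (gapIdx_lt h hl.1).eq_or_lt with e | e
        · have e' : (gapIdx l a : ℚ) + 1 = gapIdx l k := by exact_mod_cast e
          unfold pieceMap
          split_ifs <;> constructor <;> linarith
        · have e' : (gapIdx l a : ℚ) + 1 + 1 ≤ gapIdx l k := by exact_mod_cast e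
          unfold pieceMap
          split_ifs <;> constructor <;> linarith

theorem lineAction_of_exposed {l : List ℕ} {k : ℕ} (hl : l.Nodup) (hk : k ∈ l)
    (ht : Exposed l k) : lineAction (phi l) (k + 1) = gapIdx l k + 1 / 2 := by
  rw [phi_of_exposed hl hk ht, map_mul, Equiv.Perm.mul_apply, lineAction_x,
    lineAction_of_open (hl.filter _) (by simp)]
  have e : gapIdx (l.filter (· ≠ k)) k = gapIdx l k := by
    rw [← toggle_of_mem hk, gapIdx_toggle_self]
  rw [e]
  unfold pieceMap
  split_ifs <;> linarith

theorem exposed_of_lineAction {l : List ℕ} {k : ℕ} (hl : l.Nodup) (hk : k ∈ l)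
    (h : lineAction (phi l) (k + 1) = gapIdx l k + 1 / 2) : Exposed l k := by
  induction l with
  | nil => simp at hk
  | cons a l ih =>
    rw [List.nodup_cons] at hl
    by_cases hka : k = a
    · subst hka
      intro b hb
      rw [pair_sublist_cons] at hb
      rcases hb with hb | hb
      · exact absurd (hb.subset (by simp)) hl.1
      · exact absurd hb.2 hl.1
    have hkl : k ∈ l := by simpa [hka] using hk
    obtain ⟨h1, h2⟩ := lineAction_of_closed hl.2 hkl
    rw [lineAction_phi_cons] at h
    have hc := gapIdx_cons (k := k) hl.1
    obtain ⟨⟨u, hu, huk⟩, h3⟩ : (∃ u, u ∉ a :: l ∧ Between a k u) ∧ Exposed l k := by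
      rcases lt_or_gt_of_ne hka with hlt | hlt
      · rw [if_neg (by omega), add_zero] at hc
        rw [← hc] at h
        rcases (gapIdx_mono l hlt.le).eq_or_lt with e | e
        · exfalso
          rw [← e] at h
          unfold pieceMap at h
          split_ifs at h <;> linarith
        · have e' : (gapIdx l k : ℚ) + 1 ≤ gapIdx l a := by exact_mod_cast e
          rw [pieceMap, if_pos (by linarith)] at h
          obtain ⟨u, hu, hu1, hu2⟩ := exists_open_of_gapIdx_lt e
          refine ⟨⟨u, by simp [hu, hu2.ne], Or.inr ⟨lt_of_le_of_ne hu1 ?_, hu2⟩⟩, ih hl.2 hkl h⟩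
          rintro rfl
          exact hu hkl
      · rw [if_pos hlt] at hc
        have hc' : (gapIdx l k : ℚ) = gapIdx (a :: l) k + 1 := by exact_mod_cast hc
        rcases (gapIdx_lt hlt hl.1).eq_or_lt with e | e
        · have e' : (gapIdx l a : ℚ) + 1 = gapIdx l k := by exact_mod_cast e
          exfalso
          unfold pieceMap at h
          split_ifs at h <;> linarith
        · have e' : (gapIdx l a : ℚ) + 1 + 1 ≤ gapIdx l k := by exact_mod_cast e
          have h5 : lineAction (phi l) (k + 1) = gapIdx l k + 1 / 2 := by
            unfold pieceMap at h
            split_ifs at h <;> linarith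
          have e2 : gapIdx l (a + 1) < gapIdx l k := by
            rw [gapIdx_succ, if_neg hl.1]
            exact e
          obtain ⟨u, hu, hu1, hu2⟩ := exists_open_of_gapIdx_lt e2
          exact ⟨⟨u, by simp [hu, (show u ≠ a by omega)], Or.inl ⟨by omega, hu2⟩⟩,
            ih hl.2 hkl h5⟩
    intro b hb
    rw [pair_sublist_cons] at hb
    rcases hb with hb | ⟨rfl, -⟩
    · obtain ⟨v, hv, hvk⟩ := h3 b hb
      by_cases hva : v = a
      · subst hva
        refine ⟨u, hu, ?_⟩
        unfold Between at *
        omega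
      · exact ⟨v, by simp [hv, hva], hvk⟩
    · exact ⟨u, hu, huk⟩

theorem mem_of_phi_eq {l l' : List ℕ} (hl : l.Nodup) (hl' : l'.Nodup) (h : phi l = phi l')
    {k : ℕ} (hk : k ∈ l) : k ∈ l' := by
  by_contra hk'
  obtain ⟨h1, h2⟩ := lineAction_of_closed hl hk
  rw [h, lineAction_of_open hl' hk'] at h1 h2
  have e1 : gapIdx l k < gapIdx l' k + 1 := by exact_mod_cast h1
  have e2 : gapIdx l' k + 1 < gapIdx l k + 1 := by exact_mod_cast h2
  omega

theorem mem_iff_of_phi_eq {l l' : List ℕ} (hl : l.Nodup) (hl' : l'.Nodup) (h : phi l = phi l')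
    (k : ℕ) : k ∈ l ↔ k ∈ l' :=
  ⟨mem_of_phi_eq hl hl' h, mem_of_phi_eq hl' hl h.symm⟩

theorem gapIdx_eq_of_phi_eq {l l' : List ℕ} (hl : l.Nodup) (hl' : l'.Nodup)
    (h : phi l = phi l') (k : ℕ) : gapIdx l k = gapIdx l' k :=
  gapIdx_congr fun u _ => mem_iff_of_phi_eq hl hl' h u

theorem exposed_of_phi_eq {l l' : List ℕ} (hl : l.Nodup) (hl' : l'.Nodup) (h : phi l = phi l')
    {k : ℕ} (hk : k ∈ l) (ht : Exposed l k) : Exposed l' k := by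
  apply exposed_of_lineAction hl' (mem_of_phi_eq hl hl' h hk)
  rw [← h, ← gapIdx_eq_of_phi_eq hl hl' h, lineAction_of_exposed hl hk ht]

theorem exposed_head (l : List ℕ) {k : ℕ} (h : (k :: l).Nodup) : Exposed (k :: l) k := by
  intro a ha
  rw [List.nodup_cons] at h
  rw [pair_sublist_cons] at ha
  rcases ha with ha | ha
  · exact absurd (ha.subset (by simp)) h.1
  · exact absurd ha.2 h.1

theorem exposed_of_notMem {l : List ℕ} {k : ℕ} (h : k ∉ l) : Exposed l k :=
  fun _ ha => absurd (ha.subset (by simp)) h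

/-! ### Realizing words as paths of forests -/

/-- `z` is the positive element of some forest. -/
def IsPos (z : ThompsonF) : Prop := ∃ l : List ℕ, l.Nodup ∧ phi l = z

theorem isPos_one : IsPos 1 := ⟨[], List.nodup_nil, rfl⟩

theorem isPos_x_mul (i : ℕ) {z : ThompsonF} (hz : IsPos z) : IsPos (x i * z) := by
  obtain ⟨l, hl, rfl⟩ := hz
  obtain ⟨k, hk, rfl⟩ := exists_gap l i
  exact ⟨k :: l, List.nodup_cons.2 ⟨hk, hl⟩, rfl⟩

theorem isPos_phi_mul (l : List ℕ) {z : ThompsonF} (hz : IsPos z) : IsPos (phi l * z) := by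
  induction l with
  | nil => simpa [phi] using hz
  | cons k l ih =>
    rw [phi, mul_assoc]
    exact isPos_x_mul _ ih

theorem IsPos.mul {y z : ThompsonF} (hy : IsPos y) (hz : IsPos z) : IsPos (y * z) := by
  obtain ⟨l, -, rfl⟩ := hy
  exact isPos_phi_mul l hz

theorem exists_common_multiple (l : List ℕ) (i : ℕ) :
    ∃ y z, IsPos y ∧ IsPos z ∧ phi l * y = x i * z := by
  induction l generalizing i with
  | nil => exact ⟨x i * 1, 1, isPos_x_mul i isPos_one, isPos_one, by simp [phi]⟩
  | cons k l ih =>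
    rw [phi]
    generalize gapIdx l k = j
    rcases lt_trichotomy i j with h | rfl | h
    · obtain ⟨y, z, hy, hz, e⟩ := ih i
      refine ⟨y, x (j + 1) * z, hy, isPos_x_mul _ hz, ?_⟩
      rw [mul_assoc, e, ← mul_assoc, ← mul_assoc, x_comm h]
    · refine ⟨1, phi l * 1, isPos_one, isPos_phi_mul l isPos_one, by simp⟩
    · obtain ⟨y, z, hy, hz, e⟩ := ih (i + 1)
      refine ⟨y, x j * z, hy, isPos_x_mul _ hz, ?_⟩
      rw [mul_assoc, e, ← mul_assoc, ← mul_assoc, x_comm h]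

/-- Applying the letters of a word successively on the left to `z`, only positive elements
are met. -/
def StaysPos : ThompsonF → List (ℕ × Bool) → Prop
  | _, [] => True
  | z, p :: c => IsPos (letterVal p * z) ∧ StaysPos (letterVal p * z) c

theorem exists_staysPos (c : List (ℕ × Bool)) {z : ThompsonF} (hz : IsPos z) :
    ∃ y, IsPos y ∧ StaysPos (z * y) c := by
  induction c generalizing z with
  | nil => exact ⟨1, isPos_one, trivial⟩
  | cons p c ih =>
    obtain ⟨y, z', hy, hz', e⟩ : ∃ y z', IsPos y ∧ IsPos z' ∧ letterVal p * (z * y) = z' := by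
      rcases p with ⟨i, _ | _⟩
      · exact ⟨1, _, isPos_one, isPos_x_mul i hz, by simp [letterVal]⟩
      · obtain ⟨l, -, rfl⟩ := hz
        obtain ⟨y, z', hy, hz', e⟩ := exists_common_multiple l i
        exact ⟨y, z', hy, hz', by simp [letterVal, e]⟩
    obtain ⟨y', hy', h⟩ := ih hz'
    refine ⟨y * y', hy.mul hy', ?_⟩
    have e' : letterVal p * (z * (y * y')) = z' * y' := by
      rw [← e]
      group
    exact ⟨e' ▸ hz'.mul hy', e' ▸ h⟩

theorem exists_run {n : ℕ} {c : List (ℕ × Bool)} {l : List ℕ} (hl : l.Nodup)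
    (h : StaysPos (phi l) c) (hn : ∀ p ∈ c, p.1 ≤ n) :
    ∃ w, Run n l w ∧ letters l w = c := by
  induction c generalizing l with
  | nil => exact ⟨[], trivial, rfl⟩
  | cons p c ih =>
    simp only [List.mem_cons, forall_eq_or_imp] at hn
    obtain ⟨k, ht, hk⟩ : ∃ k, Exposed l k ∧ (gapIdx l k, decide (k ∈ l)) = p := by
      rcases p with ⟨i, _ | _⟩
      · obtain ⟨k, hk, rfl⟩ := exists_gap l i
        exact ⟨k, exposed_of_notMem hk, by simp [hk]⟩
      · obtain ⟨l', hl', e⟩ := h.1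
        obtain ⟨k, hk, rfl⟩ := exists_gap l' i
        have hkl' : (k :: l').Nodup := List.nodup_cons.2 ⟨hk, hl'⟩
        have e' : phi (k :: l') = phi l := by
          rw [phi, e]
          simp [letterVal]
        have hkl : k ∈ l := mem_of_phi_eq hkl' hl e' (by simp)
        refine ⟨k, exposed_of_phi_eq hkl' hl e' (by simp) (exposed_head _ hkl'), ?_⟩
        rw [← gapIdx_eq_of_phi_eq hkl' hl e',
          gapIdx_congr (l' := l') fun u hu => by simp [hu.ne]]
        simp [hkl]
    have e := phi_toggle hl ht
    rw [hk] at e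
    obtain ⟨w, hw, hc⟩ := ih (nodup_toggle hl k) (e ▸ h.2) hn.2
    refine ⟨k :: w, ⟨ht, ?_, hw⟩, by rw [letters, hc, hk]⟩
    have := hn.1
    rw [← hk] at this
    exact this

/-! ### Word length -/

theorem ln_wordVal_le {n : ℕ} {c : List (ℕ × Bool)} (hc : ∀ p ∈ c, p.1 ≤ n) :
    ln n (wordVal c) ≤ c.length := by
  apply Nat.sInf_le
  refine ⟨(c.map letterVal).reverse, by simp, ?_, rfl⟩
  intro a ha
  simp only [List.mem_reverse, List.mem_map] at ha
  obtain ⟨⟨i, b⟩, hp, rfl⟩ := ha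
  cases b
  · exact Or.inl ⟨i, hc _ hp, by simp [letterVal]⟩
  · exact Or.inr ⟨i, hc _ hp, by simp [letterVal]⟩

theorem ln_le_of_run {n : ℕ} {l w : List ℕ} {g : ThompsonF} (hl : l.Nodup) (h : Run n l w)
    (hg : phi (exec l w) = g * phi l) : ln n g ≤ w.length := by
  rw [phi_exec hl h] at hg
  rw [← mul_right_cancel hg, ← length_letters l w]
  exact ln_wordVal_le (letters_le h)

theorem exists_word_of_list {n : ℕ} (l : List ThompsonF)
    (hl : ∀ a ∈ l, a ∈ Xset n ∨ a⁻¹ ∈ Xset n) :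
    ∃ c : List (ℕ × Bool), (∀ p ∈ c, p.1 ≤ n) ∧ c.length = l.length ∧ wordVal c = l.prod := by
  induction l with
  | nil => exact ⟨[], by simp, rfl, by simp [wordVal]⟩
  | cons a l ih =>
    simp only [List.mem_cons, forall_eq_or_imp] at hl
    obtain ⟨c, h1, h2, h3⟩ := ih hl.2
    obtain ⟨p, hp, rfl⟩ : ∃ p : ℕ × Bool, p.1 ≤ n ∧ letterVal p = a := by
      rcases hl.1 with ⟨i, hi, rfl⟩ | ⟨i, hi, e⟩
      · exact ⟨(i, false), hi, by simp [letterVal]⟩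
      · exact ⟨(i, true), hi, by simp [letterVal, ← e]⟩
    refine ⟨c ++ [p], ?_, by simp [h2], ?_⟩
    · simp only [List.mem_append, List.mem_singleton]
      rintro q (hq | rfl)
      · exact h1 q hq
      · exact hp
    · rw [wordVal_append, h3]
      simp [wordVal]

theorem closure_Xset {n : ℕ} (hn : 1 ≤ n) : Subgroup.closure (Xset n) = ⊤ := by
  rw [eq_top_iff, ← PresentedGroup.closure_range_of thompsonRels, Subgroup.closure_le]
  have h0 : x 0 ∈ Subgroup.closure (Xset n) := Subgroup.subset_closure ⟨0, by omega, rfl⟩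
  have hs : ∀ k, x (k + 1) ∈ Subgroup.closure (Xset n) := by
    intro k
    induction k with
    | zero => exact Subgroup.subset_closure ⟨1, hn, rfl⟩
    | succ k ih =>
      have e : x (k + 1 + 1) = (x 0)⁻¹ * (x (k + 1) * x 0) := by
        rw [x_comm (Nat.succ_pos k)]
        simp
      rw [e]
      exact mul_mem (inv_mem h0) (mul_mem ih h0)
  rintro _ ⟨i, rfl⟩
  rcases i with _ | i
  · exact h0
  · exact hs i

theorem exists_minimal_word {n : ℕ} (hn : 1 ≤ n) (g : ThompsonF) :
    ∃ c : List (ℕ × Bool), (∀ p ∈ c, p.1 ≤ n) ∧ c.length = ln n g ∧ wordVal c = g := by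
  have hne : {m | ∃ l : List ThompsonF, l.length = m ∧
      (∀ a ∈ l, a ∈ Xset n ∨ a⁻¹ ∈ Xset n) ∧ l.prod = g}.Nonempty := by
    have hg : g ∈ Subgroup.closure (Xset n) := by
      rw [closure_Xset hn]
      trivial
    rw [← Subgroup.mem_toSubmonoid, Subgroup.closure_toSubmonoid] at hg
    obtain ⟨l, h1, h2⟩ := Submonoid.exists_list_of_mem_closure hg
    exact ⟨l.length, l, rfl, h1, h2⟩
  obtain ⟨l, h1, h2, h3⟩ := Nat.sInf_mem hne
  obtain ⟨c, hc, hlen, hval⟩ := exists_word_of_list l h2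
  exact ⟨c, hc, hlen.trans h1, hval.trans h3⟩

/-- Formal inverse of a letter. -/
def invLetter (p : ℕ × Bool) : ℕ × Bool := (p.1, !p.2)

theorem wordVal_inv (c : List (ℕ × Bool)) : wordVal (c.map invLetter).reverse = (wordVal c)⁻¹ := by
  induction c with
  | nil => simp [wordVal]
  | cons p c ih =>
    rw [List.map_cons, List.reverse_cons, wordVal_append, ih]
    rw [wordVal_cons p c, mul_inv_rev]
    rcases p with ⟨i, _ | _⟩ <;> simp [wordVal, letterVal, invLetter]

theorem ln_inv_le {n : ℕ} (hn : 1 ≤ n) (g : ThompsonF) : ln n g⁻¹ ≤ ln n g := by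
  obtain ⟨c, h1, h2, rfl⟩ := exists_minimal_word hn g
  rw [← wordVal_inv, ← h2]
  refine (ln_wordVal_le ?_).trans (by simp)
  simp only [List.mem_reverse, List.mem_map]
  rintro _ ⟨p, hp, rfl⟩
  exact h1 p hp

theorem ln_inv {n : ℕ} (hn : 1 ≤ n) (g : ThompsonF) : ln n g⁻¹ = ln n g :=
  le_antisymm (ln_inv_le hn g) (by simpa using ln_inv_le hn g⁻¹)

theorem x_add (i j : ℕ) (hi : 1 ≤ i) : x 0 ^ j * x (i + j) = x i * x 0 ^ j := by
  induction j with
  | zero => simp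
  | succ j ih =>
    rw [pow_succ, mul_assoc, ← add_assoc, ← x_comm (by omega), ← mul_assoc, ih, mul_assoc]

theorem ln_x_two_mul_le {n : ℕ} (hn : 1 ≤ n) : ln n (x (2 * n)) ≤ 2 * n + 1 := by
  have h := ln_wordVal_le (n := n)
    (c := List.replicate n (0, false) ++ [(n, false)] ++ List.replicate n (0, true)) (by
      intro p
      simp only [List.mem_append, List.mem_replicate, List.mem_singleton]
      rintro ((⟨-, rfl⟩ | rfl) | ⟨-, rfl⟩) <;> simp)
  have e : wordVal (List.replicate n (0, false) ++ [(n, false)] ++ List.replicate n (0, true))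
      = x (2 * n) := by
    rw [wordVal_append, wordVal_append]
    have := x_add n n hn
    simp only [wordVal, letterVal, List.map_replicate, List.reverse_replicate,
      List.prod_replicate, List.map_singleton, List.reverse_singleton, List.prod_singleton]
    simp only [if_true, if_false, Bool.false_eq_true, two_mul]
    rw [← this]
    group
  rw [e] at h
  simp only [List.length_append, List.length_replicate, List.length_singleton] at h
  omega

/-- The product `x 1 * x 2 * ⋯ * x m`. -/
def staircase : ℕ → ThompsonF
  | 0 => 1
  | m + 1 => staircase m * x (m + 1)

theorem ln_one_le (n : ℕ) : ln n 1 ≤ 0 := by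
  simpa [wordVal] using ln_wordVal_le (n := n) (c := []) (by simp)

theorem ln_mul_le {n : ℕ} (hn : 1 ≤ n) (g h : ThompsonF) : ln n (g * h) ≤ ln n g + ln n h := by
  obtain ⟨c, h1, h2, rfl⟩ := exists_minimal_word hn g
  obtain ⟨d, h3, h4, rfl⟩ := exists_minimal_word hn h
  rw [← wordVal_append, ← h2, ← h4]
  refine (ln_wordVal_le ?_).trans (by simp [add_comm])
  intro p hp
  rcases List.mem_append.1 hp with hp | hp
  · exact h3 p hp
  · exact h1 p hp

theorem ln_x_le {n i : ℕ} (h : i ≤ n) : ln n (x i) ≤ 1 := by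
  simpa [wordVal, letterVal] using ln_wordVal_le (n := n) (c := [(i, false)]) (by simpa using h)

theorem ln_staircase_le {n : ℕ} (hn : 1 ≤ n) : ln n (staircase (2 * n - 1)) ≤ 4 * n - 3 := by
  have h1 : ∀ m, m ≤ n → ln n (staircase m) ≤ m := by
    intro m hm
    induction m with
    | zero => exact ln_one_le n
    | succ m ih =>
      have := ln_mul_le hn (staircase m) (x (m + 1))
      have := ln_x_le hm
      have := ih (by omega)
      rw [staircase]
      omega
  have h2 : ∀ j, ln n (staircase (n + j) * (x 0 ^ j)⁻¹) ≤ n + 2 * j := by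
    intro j
    induction j with
    | zero => simpa using h1 n le_rfl
    | succ j ih =>
      have e : staircase (n + (j + 1)) * (x 0 ^ (j + 1))⁻¹ =
          staircase (n + j) * (x 0 ^ j)⁻¹ * ((x 0)⁻¹ * x n) := by
        have h := x_add n (j + 1) hn
        rw [← add_assoc, staircase]
        have h' : x (n + j + 1) = (x 0 ^ (j + 1))⁻¹ * (x n * x 0 ^ (j + 1)) := by
          rw [← h, add_assoc]
          simp
        rw [h', pow_succ]
        group
      rw [e]
      have a1 := ln_mul_le hn (staircase (n + j) * (x 0 ^ j)⁻¹) ((x 0)⁻¹ * x n)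
      have a2 := ln_mul_le hn (x 0)⁻¹ (x n)
      have a3 := ln_x_le (le_refl n)
      have a4 := ln_x_le (Nat.zero_le n)
      rw [ln_inv hn] at a2
      omega
  have h3 : ∀ j, ln n (x 0 ^ j) ≤ j := by
    intro j
    induction j with
    | zero => simpa using ln_one_le n
    | succ j ih =>
      rw [pow_succ]
      have := ln_mul_le hn (x 0 ^ j) (x 0)
      have := ln_x_le (Nat.zero_le n)
      omega
  have e : staircase (2 * n - 1) =
      staircase (n + (n - 1)) * (x 0 ^ (n - 1))⁻¹ * x 0 ^ (n - 1) := by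
    rw [inv_mul_cancel_right]
    congr 1
    omega
  rw [e]
  have := ln_mul_le hn (staircase (n + (n - 1)) * (x 0 ^ (n - 1))⁻¹) (x 0 ^ (n - 1))
  have := h2 (n - 1)
  have := h3 (n - 1)
  omega

/-! ### Coarsening

For a monotone surjection `c` of the set of gaps, a forest is coarsened by keeping, for each fiber
of `c`, only the moment when all its gaps have become closed. -/

open Classical in
/-- The coarsening of a forest along `c`. -/
noncomputable def coarse (c : ℕ → ℕ) : List ℕ → List ℕ
  | [] => []
  | k :: l => if ∀ i, c i = c k → i = k ∨ i ∈ l then c k :: coarse c l else coarse c l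

section Coarse

variable {c : ℕ → ℕ}

theorem coarse_cons_pos {k : ℕ} {l : List ℕ} (h : ∀ i, c i = c k → i = k ∨ i ∈ l) :
    coarse c (k :: l) = c k :: coarse c l := by
  rw [coarse, if_pos h]

theorem coarse_cons_neg {k i : ℕ} {l : List ℕ} (hi : c i = c k) (hik : i ≠ k) (hil : i ∉ l) :
    coarse c (k :: l) = coarse c l := by
  rw [coarse, if_neg]
  intro h
  exact (h i hi).elim hik hil

theorem coarse_cons_congr {k : ℕ} {l l' : List ℕ}
    (h : ∀ i, c i = c k → (i ∈ l ↔ i ∈ l')) :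
    (coarse c (k :: l) = c k :: coarse c l ∧ coarse c (k :: l') = c k :: coarse c l') ∨
      (coarse c (k :: l) = coarse c l ∧ coarse c (k :: l') = coarse c l') := by
  by_cases hc : ∀ i, c i = c k → i = k ∨ i ∈ l
  · exact Or.inl ⟨coarse_cons_pos hc, coarse_cons_pos fun i hi => (hc i hi).imp_right (h i hi).1⟩
  · push Not at hc
    obtain ⟨i, hi, hik, hil⟩ := hc
    exact Or.inr ⟨coarse_cons_neg hi hik hil, coarse_cons_neg hi hik (mt (h i hi).2 hil)⟩

theorem mem_coarse (hs : Function.Surjective c) {l : List ℕ} {j : ℕ} :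
    j ∈ coarse c l ↔ ∀ i, c i = j → i ∈ l := by
  induction l with
  | nil =>
    obtain ⟨i, hi⟩ := hs j
    simp only [coarse, List.not_mem_nil, imp_false, false_iff, not_forall, not_not]
    exact ⟨i, hi⟩
  | cons k l ih =>
    unfold coarse
    split_ifs with h
    · simp only [List.mem_cons, ih]
      constructor
      · rintro (rfl | h') i hi
        · exact h i hi
        · exact Or.inr (h' i hi)
      · intro h'
        by_cases hj : j = c k
        · exact Or.inl hj
        · refine Or.inr fun i hi => (h' i hi).resolve_left ?_
          rintro rfl
          exact hj hi.symm
    · rw [ih]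
      constructor
      · exact fun h' i hi => List.mem_cons_of_mem _ (h' i hi)
      · intro h' i hi
        by_cases hj : j = c k
        · subst hj
          exact absurd (fun i hi => List.mem_cons.1 (h' i hi)) h
        · refine (List.mem_cons.1 (h' i hi)).resolve_left ?_
          rintro rfl
          exact hj hi.symm

theorem nodup_coarse (hs : Function.Surjective c) {l : List ℕ} (hl : l.Nodup) :
    (coarse c l).Nodup := by
  induction l with
  | nil => simp [coarse]
  | cons k l ih =>
    rw [List.nodup_cons] at hl
    unfold coarse
    split_ifs
    · exact List.nodup_cons.2 ⟨fun h => hl.1 ((mem_coarse hs).1 h k rfl), ih hl.2⟩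
    · exact ih hl.2

theorem gapIdx_coarse_le (hm : Monotone c) (hs : Function.Surjective c) (l : List ℕ) (k : ℕ) :
    gapIdx (coarse c l) (c k) ≤ gapIdx l k := by
  unfold gapIdx
  refine (Finset.card_le_card ?_).trans (Finset.card_image_le (f := c))
  intro j hj
  simp only [Finset.mem_filter, Finset.mem_range, mem_coarse hs, not_forall] at hj
  obtain ⟨hj, i, rfl, hi⟩ := hj
  refine Finset.mem_image_of_mem c ?_
  simp only [Finset.mem_filter, Finset.mem_range]
  exact ⟨hm.reflect_lt hj, hi⟩

theorem coarse_filter_of_incomplete {l : List ℕ} {k : ℕ} (h : ∃ i, c i = c k ∧ i ∉ l) :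
    coarse c (l.filter (· ≠ k)) = coarse c l := by
  induction l with
  | nil => rfl
  | cons a l ih =>
    obtain ⟨i, hi, hil⟩ := h
    simp only [List.mem_cons, not_or] at hil
    have ih' := ih ⟨i, hi, hil.2⟩
    by_cases hak : a = k
    · subst hak
      rw [List.filter_cons_of_neg (by simp), ih', coarse_cons_neg hi hil.1 hil.2]
    · rw [List.filter_cons_of_pos (by simpa using hak)]
      by_cases hc : c a = c k
      · rw [coarse_cons_neg (hi.trans hc.symm) hil.1 hil.2, ← ih',
          coarse_cons_neg (hi.trans hc.symm) hil.1 fun h => hil.2 (List.mem_filter.1 h).1]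
      · have e : ∀ i, c i = c a → (i ∈ l.filter (· ≠ k) ↔ i ∈ l) := by
          intro j hj
          have : j ≠ k := by
            rintro rfl
            exact hc hj.symm
          simp [this]
        rcases coarse_cons_congr e with ⟨e1, e2⟩ | ⟨e1, e2⟩ <;> rw [e1, e2, ih']

theorem coarse_filter_of_complete (hs : Function.Surjective c) {l : List ℕ} {k : ℕ}
    (hl : l.Nodup) (hc : ∀ i, c i = c k → i ∈ l) (ht : ∀ a, c a = c k → ¬ [a, k] <+ l) :
    coarse c (l.filter (· ≠ k)) = (coarse c l).filter (· ≠ c k) := by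
  induction l with
  | nil => exact absurd (hc k rfl) (by simp)
  | cons a l ih =>
    rw [List.nodup_cons] at hl
    by_cases hak : a = k
    · subst hak
      rw [List.filter_cons_of_neg (by simp), filter_ne_of_notMem hl.1]
      rw [coarse_cons_pos (fun i hi => List.mem_cons.1 (hc i hi)),
        List.filter_cons_of_neg (by simp),
        filter_ne_of_notMem fun h => hl.1 ((mem_coarse hs).1 h a rfl)]
    · have hkl : k ∈ l := (List.mem_cons.1 (hc k rfl)).resolve_left (Ne.symm hak)
      have hca : c a ≠ c k := fun h => ht a h (pair_sublist_cons.2 (Or.inr ⟨rfl, hkl⟩))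
      have ih' := ih hl.2
        (fun i hi => (List.mem_cons.1 (hc i hi)).resolve_left (by rintro rfl; exact hca hi))
        (fun b hb h => ht b hb (h.trans (List.sublist_cons_self _ _)))
      rw [List.filter_cons_of_pos (by simpa using hak)]
      have e : ∀ i, c i = c a → (i ∈ l.filter (· ≠ k) ↔ i ∈ l) := by
        intro j hj
        have : j ≠ k := by
          rintro rfl
          exact hca hj.symm
        simp [this]
      rcases coarse_cons_congr e with ⟨e1, e2⟩ | ⟨e1, e2⟩
      · rw [e1, e2, ih', List.filter_cons_of_pos (by simpa using hca)]
      · rw [e1, e2, ih']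

theorem pair_of_coarse_pair (hs : Function.Surjective c) {l : List ℕ} {k j : ℕ}
    (hl : l.Nodup) (hc : ∀ i, c i = c k → i ∈ l) (ht : ∀ a, c a = c k → ¬ [a, k] <+ l)
    (hj : [j, c k] <+ coarse c l) : ∃ a, c a = j ∧ [a, k] <+ l := by
  induction l with
  | nil => exact absurd (hc k rfl) (by simp)
  | cons a l ih =>
    rw [List.nodup_cons] at hl
    by_cases hak : a = k
    · subst hak
      have hn : c a ∉ coarse c l := fun h => hl.1 ((mem_coarse hs).1 h a rfl)
      rw [coarse_cons_pos (fun i hi => List.mem_cons.1 (hc i hi)), pair_sublist_cons] at hj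
      rcases hj with hj | hj
      · exact absurd (hj.subset (by simp)) hn
      · exact absurd hj.2 hn
    · have hkl : k ∈ l := (List.mem_cons.1 (hc k rfl)).resolve_left (Ne.symm hak)
      have hca : c a ≠ c k := fun h => ht a h (pair_sublist_cons.2 (Or.inr ⟨rfl, hkl⟩))
      have ih' := ih hl.2
        (fun i hi => (List.mem_cons.1 (hc i hi)).resolve_left (by rintro rfl; exact hca hi))
        (fun b hb h => ht b hb (h.trans (List.sublist_cons_self _ _)))
      have key : [j, c k] <+ coarse c l → ∃ b, c b = j ∧ [b, k] <+ a :: l := by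
        intro h
        obtain ⟨b, hb, hb'⟩ := ih' h
        exact ⟨b, hb, hb'.trans (List.sublist_cons_self _ _)⟩
      unfold coarse at hj
      split_ifs at hj
      · rw [pair_sublist_cons] at hj
        rcases hj with hj | hj
        · exact key hj
        · exact ⟨a, hj.1.symm, pair_sublist_cons.2 (Or.inr ⟨rfl, hkl⟩)⟩
      · exact key hj

theorem coarse_toggle_of_incomplete {l : List ℕ} {k i : ℕ} (hi : c i = c k) (hik : i ≠ k)
    (hil : i ∉ l) : coarse c (toggle l k) = coarse c l := by
  unfold toggle
  split_ifs
  · exact coarse_filter_of_incomplete ⟨i, hi, hil⟩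
  · exact coarse_cons_neg hi hik hil

theorem coarse_toggle_of_complete (hm : Monotone c) (hs : Function.Surjective c) {l : List ℕ}
    {k : ℕ} (hl : l.Nodup) (ht : Exposed l k) (h : ∀ i, c i = c k → i = k ∨ i ∈ l) :
    coarse c (toggle l k) = toggle (coarse c l) (c k) ∧ Exposed (coarse c l) (c k) := by
  by_cases hk : k ∈ l
  · have hc : ∀ i, c i = c k → i ∈ l := fun i hi => by
      rcases h i hi with rfl | h
      · exact hk
      · exact h
    have ht' : ∀ a, c a = c k → ¬ [a, k] <+ l := by
      intro a ha hal
      obtain ⟨u, hu, hau⟩ := ht a hal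
      refine hu (hc u ?_)
      rcases hau with hau | hau
      · exact le_antisymm (hm hau.2.le) (ha ▸ hm hau.1.le)
      · exact le_antisymm (ha ▸ hm hau.2.le) (hm hau.1.le)
    rw [toggle_of_mem hk, toggle_of_mem ((mem_coarse hs).2 hc)]
    refine ⟨coarse_filter_of_complete hs hl hc ht', fun j hj => ?_⟩
    obtain ⟨a, rfl, ha⟩ := pair_of_coarse_pair hs hl hc ht' hj
    obtain ⟨u, hu, hau⟩ := ht a ha
    have h1 : c u ∉ coarse c l := fun h => hu ((mem_coarse hs).1 h u rfl)
    have h2 : c u ≠ c k := fun h => hu (hc u h)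
    have h3 : c u ≠ c a := fun h => h1 (h ▸ hj.subset (by simp))
    refine ⟨c u, h1, ?_⟩
    rcases hau with hau | hau
    · exact Or.inl ⟨lt_of_le_of_ne (hm hau.1.le) h3.symm, lt_of_le_of_ne (hm hau.2.le) h2⟩
    · exact Or.inr ⟨lt_of_le_of_ne (hm hau.1.le) h2.symm, lt_of_le_of_ne (hm hau.2.le) h3⟩
  · have hk' : c k ∉ coarse c l := fun h => hk ((mem_coarse hs).1 h k rfl)
    rw [toggle_of_notMem hk, toggle_of_notMem hk', coarse_cons_pos h]
    exact ⟨rfl, exposed_of_notMem hk'⟩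

theorem exists_coarse_run (hm : Monotone c) (hs : Function.Surjective c) {n : ℕ} {l w : List ℕ}
    (hl : l.Nodup) (h : Run n l w) :
    ∃ w', Run n (coarse c l) w' ∧ exec (coarse c l) w' = coarse c (exec l w) ∧
      w'.length ≤ w.length := by
  induction w generalizing l with
  | nil => exact ⟨[], trivial, rfl, le_rfl⟩
  | cons k w ih =>
    obtain ⟨w', h1, h2, h3⟩ := ih (nodup_toggle hl k) h.2.2
    by_cases hc : ∀ i, c i = c k → i = k ∨ i ∈ l
    · obtain ⟨e, ht⟩ := coarse_toggle_of_complete hm hs hl h.1 hc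
      rw [e] at h1 h2
      exact ⟨c k :: w', ⟨ht, (gapIdx_coarse_le hm hs l k).trans h.2.1, h1⟩, h2, by simpa using h3⟩
    · push Not at hc
      obtain ⟨i, hi, hik, hil⟩ := hc
      have e := coarse_toggle_of_incomplete hi hik hil
      rw [e] at h1 h2
      exact ⟨w', h1, h2, by simp only [List.length_cons]; omega⟩

theorem exists_shorter_coarse_run (hm : Monotone c) (hs : Function.Surjective c) {n : ℕ}
    {l u v : List ℕ} {k i : ℕ} (hl : l.Nodup) (h : Run n l (u ++ k :: v)) (hi : c i = c k)
    (hik : i ≠ k) (hil : i ∉ exec l u) :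
    ∃ w', Run n (coarse c l) w' ∧ exec (coarse c l) w' = coarse c (exec l (u ++ k :: v)) ∧
      w'.length < (u ++ k :: v).length := by
  rw [run_append] at h
  obtain ⟨w₁, h1, h2, h3⟩ := exists_coarse_run hm hs hl h.1
  obtain ⟨w₂, h4, h5, h6⟩ :=
    exists_coarse_run hm hs (nodup_toggle (nodup_exec hl u) k) h.2.2.2
  rw [coarse_toggle_of_incomplete hi hik hil] at h4 h5
  refine ⟨w₁ ++ w₂, ?_, ?_, ?_⟩
  · rw [run_append, h2]
    exact ⟨h1, h4⟩
  · rw [exec_append, exec_append, h2, h5, exec_cons]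
  · simp only [List.length_append, List.length_cons]
    omega

theorem phi_coarse_congr (hm : Monotone c) (hs : Function.Surjective c) {l l' : List ℕ}
    (hl : l.Nodup) (hl' : l'.Nodup) (h : phi l = phi l') :
    phi (coarse c l) = phi (coarse c l') := by
  induction l generalizing l' with
  | nil =>
    have : l' = [] := List.eq_nil_iff_forall_not_mem.2 fun k hk => by
      simpa using mem_of_phi_eq hl' hl h.symm hk
    rw [this]
  | cons k l ih =>
    have hmem := mem_iff_of_phi_eq hl hl' h
    have hkl' : k ∈ l' := (hmem k).1 (by simp)
    have ht := exposed_of_phi_eq hl hl' h (by simp) (exposed_head _ hl)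
    have hidx := gapIdx_eq_of_phi_eq hl hl' h k
    have e1 : gapIdx (k :: l) k = gapIdx l k := gapIdx_congr fun u hu => by simp [hu.ne]
    have hl0 := (List.nodup_cons.1 hl).2
    have e2 : phi l = phi (toggle l' k) := by
      rw [toggle_of_mem hkl']
      rw [phi_of_exposed hl' hkl' ht, phi, ← hidx, e1] at h
      exact mul_left_cancel h
    have ih' := ih hl0 (nodup_toggle hl' k) e2
    by_cases hc : ∀ i, c i = c k → i = k ∨ i ∈ l
    · rw [coarse_cons_pos hc]
      have hc' : ∀ i, c i = c k → i = k ∨ i ∈ l' := fun i hi =>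
        Or.inr ((hmem i).1 (List.mem_cons.2 (hc i hi)))
      obtain ⟨e3, ht'⟩ := coarse_toggle_of_complete hm hs hl' ht hc'
      have hck : c k ∈ coarse c l' := (mem_coarse hs).2 fun i hi =>
        (hmem i).1 (List.mem_cons.2 (hc i hi))
      rw [e3, toggle_of_mem hck] at ih'
      rw [phi_of_exposed (nodup_coarse hs hl') hck ht', phi, ih']
      congr 2
      apply gapIdx_congr
      intro j hj
      rw [mem_coarse hs, mem_coarse hs]
      refine forall_congr' fun i => imp_congr_right fun hi => ?_
      rw [← hmem, List.mem_cons]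
      have : i ≠ k := by
        rintro rfl
        omega
      simp [this]
    · push Not at hc
      obtain ⟨i, hi, hik, hil⟩ := hc
      have : i ∉ l' := fun h' => by
        have := (hmem i).2 h'
        simp [hik, hil] at this
      rw [coarse_cons_neg hi hik hil, ih', coarse_toggle_of_incomplete hi hik this]

end Coarse

/-! ### Removing gaps that stay closed -/

/-- The map of gaps induced by merging the gap `k₀` with the next one. -/
def squash (k₀ k : ℕ) : ℕ := if k ≤ k₀ then k else k - 1

theorem squash_mono (k₀ : ℕ) : Monotone (squash k₀) := by
  intro a b h
  unfold squash
  split_ifs <;> omega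

theorem squash_surj (k₀ : ℕ) : Function.Surjective (squash k₀) := by
  intro j
  by_cases h : j ≤ k₀
  · exact ⟨j, by simp [squash, h]⟩
  · exact ⟨j + 1, by unfold squash; split_ifs <;> omega⟩

theorem squash_injOn {k₀ i j : ℕ} (hi : i ≠ k₀) (hj : j ≠ k₀) (h : squash k₀ i = squash k₀ j) :
    i = j := by
  unfold squash at h
  split_ifs at h <;> omega

theorem gapIdx_coarse_squash {k₀ k : ℕ} {l : List ℕ} (h₀ : k₀ ∈ l) (hk : k ≠ k₀) :
    gapIdx (coarse (squash k₀) l) (squash k₀ k) = gapIdx l k := by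
  apply le_antisymm (gapIdx_coarse_le (squash_mono k₀) (squash_surj k₀) l k)
  unfold gapIdx
  apply Finset.card_le_card_of_injOn (squash k₀)
  · intro u hu
    simp only [Finset.coe_filter, Finset.mem_range, Set.mem_ofPred_eq] at hu ⊢
    refine ⟨?_, fun h => hu.2 ((mem_coarse (squash_surj k₀)).1 h u rfl)⟩
    refine lt_of_le_of_ne (squash_mono k₀ hu.1.le) fun h => ?_
    have : u ≠ k₀ := by
      rintro rfl
      exact hu.2 h₀
    have := squash_injOn this hk h
    omega
  · intro u hu v hv huv
    simp only [Finset.coe_filter, Finset.mem_range, Set.mem_ofPred_eq] at hu hv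
    refine squash_injOn ?_ ?_ huv
    · rintro rfl
      exact hu.2 h₀
    · rintro rfl
      exact hv.2 h₀

theorem length_coarse_squash_lt {k₀ : ℕ} {l : List ℕ} (hl : l.Nodup) (h₀ : k₀ ∈ l) :
    (coarse (squash k₀) l).length < l.length := by
  rw [← List.toFinset_card_of_nodup (nodup_coarse (squash_surj k₀) hl),
    ← List.toFinset_card_of_nodup hl]
  have h1 : (coarse (squash k₀) l).toFinset ⊆ (l.toFinset.erase k₀).image (squash k₀) := by
    intro j hj
    rw [List.mem_toFinset, mem_coarse (squash_surj k₀)] at hj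
    obtain ⟨i, hi, hi'⟩ : ∃ i, squash k₀ i = j ∧ i ≠ k₀ := by
      by_cases h : j < k₀
      · exact ⟨j, by unfold squash; split_ifs <;> omega, by omega⟩
      · exact ⟨j + 1, by unfold squash; split_ifs <;> omega, by omega⟩
    rw [Finset.mem_image]
    exact ⟨i, by simp [hi', hj i hi], hi⟩
  have h2 := (Finset.card_le_card h1).trans Finset.card_image_le
  rw [Finset.card_erase_of_mem (by simpa using h₀)] at h2
  have : 0 < l.toFinset.card := Finset.card_pos.2 ⟨k₀, by simpa using h₀⟩
  omega

theorem run_coarse_squash {k₀ n : ℕ} {l w : List ℕ} (hl : l.Nodup) (h₀ : k₀ ∈ l) (hw : k₀ ∉ w)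
    (h : Run n l w) :
    Run n (coarse (squash k₀) l) (w.map (squash k₀)) ∧
      letters (coarse (squash k₀) l) (w.map (squash k₀)) = letters l w := by
  induction w generalizing l with
  | nil => exact ⟨trivial, rfl⟩
  | cons k w ih =>
    simp only [List.mem_cons, not_or] at hw
    have hc : ∀ i, squash k₀ i = squash k₀ k → i = k ∨ i ∈ l := by
      intro i hi
      by_cases h : i = k₀
      · exact Or.inr (h ▸ h₀)
      · exact Or.inl (squash_injOn h (Ne.symm hw.1) hi)
    obtain ⟨e, ht⟩ := coarse_toggle_of_complete (squash_mono k₀) (squash_surj k₀) hl h.1 hc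
    obtain ⟨h1, h2⟩ := ih (nodup_toggle hl k) (by rw [mem_toggle]; exact Or.inr ⟨hw.1, h₀⟩)
      hw.2 h.2.2
    rw [e] at h1 h2
    have hg := gapIdx_coarse_squash h₀ (Ne.symm hw.1)
    refine ⟨⟨ht, hg.symm ▸ h.2.1, h1⟩, ?_⟩
    rw [List.map_cons, letters, letters, h2, hg]
    congr 2
    rw [decide_eq_decide, mem_coarse (squash_surj k₀)]
    refine ⟨fun h => h k rfl, fun hk i hi => ?_⟩
    rcases hc i hi with rfl | h
    · exact hk
    · exact h

theorem exists_tight_run {n : ℕ} {c : List (ℕ × Bool)} (hc : ∀ p ∈ c, p.1 ≤ n) :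
    ∃ l w, l.Nodup ∧ Run n l w ∧ letters l w = c ∧ ∀ k ∈ l, k ∈ w := by
  obtain ⟨y, ⟨l, hl, rfl⟩, hy⟩ := exists_staysPos c isPos_one
  rw [one_mul] at hy
  obtain ⟨w, hw, e⟩ := exists_run hl hy hc
  clear hy
  generalize hm : l.length = m
  induction m using Nat.strong_induction_on generalizing l w with
  | _ m ih =>
    by_cases h : ∀ k ∈ l, k ∈ w
    · exact ⟨l, w, hl, hw, e, h⟩
    · push Not at h
      obtain ⟨k, hk, hkw⟩ := h
      obtain ⟨h1, h2⟩ := run_coarse_squash hl hk hkw hw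
      exact ih _ (hm ▸ length_coarse_squash_lt hl hk) _ (nodup_coarse (squash_surj k) hl) _ h1
        (h2.trans e) rfl

/-! ### Inserting a forest below another one -/

theorem exists_last {p : ℕ → Prop} {w : List ℕ} (h : ∃ k ∈ w, p k) :
    ∃ u k v, w = u ++ k :: v ∧ p k ∧ ∀ j ∈ v, ¬ p j := by
  induction w with
  | nil => simp at h
  | cons a w ih =>
    by_cases hw : ∃ k ∈ w, p k
    · obtain ⟨u, k, v, rfl, h1, h2⟩ := ih hw
      exact ⟨a :: u, k, v, rfl, h1, h2⟩
    · push Not at hw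
      obtain ⟨k, hk, hp⟩ := h
      rcases List.mem_cons.1 hk with rfl | hk
      · exact ⟨[], k, w, rfl, hp, hw⟩
      · exact absurd hp (hw k hk)

theorem mem_of_mem_exec_ne {l w : List ℕ} {k : ℕ} (h : ¬ (k ∈ exec l w ↔ k ∈ l)) : k ∈ w := by
  by_contra hw
  exact h (mem_exec_of_notMem hw)

/-- `lift` enumerates the open gaps of the forest `Z`. -/
def Enumerates (Z : List ℕ) (lift : ℕ → ℕ) : Prop := ∀ j, lift j ∉ Z ∧ gapIdx Z (lift j) = j

theorem exists_enumerates (Z : List ℕ) : ∃ lift, Enumerates Z lift := by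
  choose lift h using exists_gap Z
  exact ⟨lift, h⟩

section Enumerates

variable {Z : List ℕ} {lift : ℕ → ℕ}

theorem Enumerates.eq_of_open (he : Enumerates Z lift) {k : ℕ} (hk : k ∉ Z) :
    lift (gapIdx Z k) = k :=
  open_gap_unique (he _).1 hk (he _).2

theorem Enumerates.injective (he : Enumerates Z lift) : Function.Injective lift := fun i j h => by
  rw [← (he i).2, h, (he j).2]

theorem Enumerates.strictMono (he : Enumerates Z lift) : StrictMono lift := by
  intro i j h
  by_contra hc
  have := gapIdx_mono Z (not_lt.1 hc)
  rw [(he i).2, (he j).2] at this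
  omega

theorem Enumerates.notMem (he : Enumerates Z lift) {l : List ℕ} {k : ℕ} (h : k ∉ l) :
    lift k ∉ l.map lift ++ Z := by
  simp only [List.mem_append, not_or]
  exact ⟨fun h' => h ((List.mem_map_of_injective he.injective).1 h'), (he k).1⟩

theorem Enumerates.nodup (he : Enumerates Z lift) {l : List ℕ} (hl : l.Nodup) (hZ : Z.Nodup) :
    (l.map lift ++ Z).Nodup := by
  rw [List.nodup_append']
  refine ⟨hl.map he.injective, hZ, ?_⟩
  intro a ha haZ
  obtain ⟨b, -, rfl⟩ := List.mem_map.1 ha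
  exact (he b).1 haZ

theorem Enumerates.gapIdx_lift (he : Enumerates Z lift) (l : List ℕ) (k : ℕ) :
    gapIdx (l.map lift ++ Z) (lift k) = gapIdx l k := by
  unfold gapIdx
  rw [← Finset.card_image_of_injective ((Finset.range k).filter (· ∉ l)) he.injective]
  congr 1
  ext u
  simp only [Finset.mem_filter, Finset.mem_range, Finset.mem_image]
  constructor
  · rintro ⟨h1, h2⟩
    have hu : u ∉ Z := fun h => h2 (List.mem_append_right _ h)
    have e := he.eq_of_open hu
    rw [← e] at h1 h2
    exact ⟨gapIdx Z u, ⟨he.strictMono.lt_iff_lt.1 h1,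
      fun h => h2 (List.mem_append_left _ (List.mem_map_of_mem h))⟩, e⟩
  · rintro ⟨j, ⟨h1, h2⟩, rfl⟩
    exact ⟨he.strictMono h1, he.notMem h2⟩

theorem Enumerates.phi_append (he : Enumerates Z lift) (l : List ℕ) :
    phi (l.map lift ++ Z) = phi l * phi Z := by
  induction l with
  | nil => simp [phi]
  | cons k l ih => rw [List.map_cons, List.cons_append, phi, phi, he.gapIdx_lift, ih, mul_assoc]

theorem Enumerates.surjective (he : Enumerates Z lift) : Function.Surjective (gapIdx Z) :=
  fun j => ⟨lift j, (he j).2⟩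

theorem Enumerates.coarse_append (he : Enumerates Z lift) {Y l : List ℕ} (hY : Y ⊆ Z)
    (h : ∀ i ∈ Z, i ∉ Y → gapIdx Z i ∉ l) : coarse (gapIdx Z) (l.map lift ++ Y) = l := by
  induction l with
  | nil =>
    rw [List.eq_nil_iff_forall_not_mem]
    intro j hj
    rw [mem_coarse he.surjective] at hj
    exact (he j).1 (hY (hj (lift j) (he j).2))
  | cons k l ih =>
    rw [List.map_cons, List.cons_append, coarse_cons_pos,
      ih fun i hi hi' h' => h i hi hi' (List.mem_cons_of_mem _ h'), (he k).2]
    intro i hi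
    rw [(he k).2] at hi
    by_cases hiZ : i ∈ Z
    · refine Or.inr (List.mem_append_right _ ?_)
      by_contra hiY
      exact h i hiZ hiY (by simp [hi])
    · left
      rw [← he.eq_of_open hiZ, hi]

end Enumerates

theorem filter_map_lift_append {Y l : List ℕ} {κ : ℕ} {lift : ℕ → ℕ} (hκ : κ ∉ Y)
    (he : Enumerates (κ :: Y) lift) :
    (l.map lift ++ κ :: Y).filter (· ≠ κ) = l.map lift ++ Y := by
  rw [List.filter_append, filter_ne_of_notMem, List.filter_cons_of_neg (by simp),
    filter_ne_of_notMem hκ]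
  intro h
  obtain ⟨b, -, hb⟩ := List.mem_map.1 h
  exact (he b).1 (by simp [hb])

theorem exposed_lift_append {Y l : List ℕ} {κ p : ℕ} {lift : ℕ → ℕ} (hl : l.Nodup)
    (hZ : (κ :: Y).Nodup) (he : Enumerates (κ :: Y) lift) (hκ : gapIdx (κ :: Y) κ = p + 1)
    (h1 : p ∉ l) (h2 : p + 1 ∉ l) :
    lift p < κ ∧ κ < lift (p + 1) ∧ Exposed (l.map lift ++ κ :: Y) κ ∧
      gapIdx (l.map lift ++ κ :: Y) κ = gapIdx l (p + 1) := by
  have b1 : lift p < κ := by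
    by_contra hc
    have := gapIdx_mono (κ :: Y) (not_lt.1 hc)
    rw [(he p).2] at this
    omega
  have b2 : κ < lift (p + 1) := by
    rcases lt_trichotomy κ (lift (p + 1)) with h | h | h
    · exact h
    · exact absurd (by simp [← h]) (he (p + 1)).1
    · have := gapIdx_lt h (he (p + 1)).1
      rw [(he (p + 1)).2] at this
      omega
  refine ⟨b1, b2, ?_, ?_⟩
  · intro a ha
    have haL : a ∈ l.map lift := by
      have hnd := he.nodup hl hZ
      clear b1 b2 h1 h2 hl
      generalize l.map lift = L at *
      induction L with
      | nil =>
        rw [List.nil_append, pair_sublist_cons] at ha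
        rw [List.nodup_cons] at hZ
        rcases ha with ha | ha
        · exact absurd (ha.subset (by simp)) hZ.1
        · exact absurd ha.2 hZ.1
      | cons b L ih =>
        rw [List.cons_append, pair_sublist_cons] at ha
        rcases ha with ha | ha
        · exact List.mem_cons_of_mem _ (ih ha (List.nodup_cons.1 hnd).2)
        · simp [ha.1]
    obtain ⟨b, hb, rfl⟩ := List.mem_map.1 haL
    have hb1 : b ≠ p := fun h => h1 (h ▸ hb)
    have hb2 : b ≠ p + 1 := fun h => h2 (h ▸ hb)
    rcases lt_or_ge b p with h | h
    · exact ⟨lift p, he.notMem h1, Or.inl ⟨he.strictMono h, b1⟩⟩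
    · exact ⟨lift (p + 1), he.notMem h2, Or.inr ⟨b2, he.strictMono (by omega)⟩⟩
  · rw [← he.gapIdx_lift l (p + 1)]
    apply le_antisymm (gapIdx_mono _ b2.le)
    apply gapIdx_le_of_closed
    intro u hu hu'
    refine List.mem_append_right _ ?_
    by_contra hc
    have e1 := gapIdx_lt hu' hc
    have e2 := gapIdx_mono (κ :: Y) hu
    rw [(he _).2] at e1
    omega

/-- If two adjacent gaps are open in the forest reached by `f`, then multiplying by the inverse of
the generator of the second one increases the length. -/
theorem ln_lt_of_adjacent_open {n p : ℕ} (hn : 1 ≤ n) {P Q : List ℕ} {f : ThompsonF}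
    (hP : P.Nodup) (hQ : Q.Nodup) (hf : phi Q = f * phi P) (h1 : p ∉ Q) (h2 : p + 1 ∉ Q) :
    ln n f < ln n ((x (gapIdx Q (p + 1)))⁻¹ * f) := by
  obtain ⟨c, hc, hlen, hval⟩ := exists_minimal_word hn ((x (gapIdx Q (p + 1)))⁻¹ * f)
  obtain ⟨_, ⟨Y, hY, rfl⟩, hpos⟩ := exists_staysPos c
    (isPos_phi_mul P (isPos_x_mul (p + 1) isPos_one))
  obtain ⟨κ, hκ, hκp⟩ := exists_gap Y (p + 1)
  have hZ : (κ :: Y).Nodup := List.nodup_cons.2 ⟨hκ, hY⟩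
  have hκZ : gapIdx (κ :: Y) κ = p + 1 := by
    rw [← hκp]
    exact gapIdx_congr fun u hu => by simp [hu.ne]
  obtain ⟨lift, he⟩ := exists_enumerates (κ :: Y)
  have eP : phi (P.map lift ++ κ :: Y) = phi P * (x (p + 1) * 1) * phi Y := by
    rw [he.phi_append, phi, hκp]
    simp [mul_assoc]
  have ndP := he.nodup hP hZ
  rw [← eP] at hpos
  obtain ⟨w, hw, hwc⟩ := exists_run ndP hpos hc
  obtain ⟨-, b2, ht, hidx⟩ := exposed_lift_append hQ hZ he hκZ h1 h2
  have ndQ := he.nodup hQ hZ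
  have eQ := phi_of_exposed ndQ (by simp) ht
  have ndQ' := ndQ.filter (· ≠ κ)
  rw [filter_map_lift_append hκ he] at eQ ndQ'
  have eE : phi (exec (P.map lift ++ κ :: Y) w) = phi (Q.map lift ++ Y) := by
    rw [phi_exec ndP hw, hwc, hval]
    rw [he.phi_append, hf, hidx] at eQ
    rw [eq_inv_mul_of_mul_eq eQ.symm, he.phi_append]
    group
  have ndE := nodup_exec ndP w
  have hmem := mem_iff_of_phi_eq ndE ndQ' eE
  have hκE : κ ∉ exec (P.map lift ++ κ :: Y) w := by
    rw [hmem, ← filter_map_lift_append hκ he]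
    simp
  have hlE : lift (p + 1) ∉ exec (P.map lift ++ κ :: Y) w := by
    rw [hmem]
    intro h
    refine he.notMem h2 ?_
    rw [List.mem_append] at h ⊢
    exact h.imp_right (List.mem_cons_of_mem _)
  have hκw : κ ∈ w := mem_of_mem_exec_ne (l := P.map lift ++ κ :: Y) (by simp [hκE])
  obtain ⟨u, k, v, rfl, hk, hv⟩ :=
    exists_last (p := fun k => k = κ ∨ k = lift (p + 1)) ⟨κ, hκw, Or.inl rfl⟩
  obtain ⟨i, hik, hi, hiE⟩ : ∃ i, i ≠ k ∧ (i = κ ∨ i = lift (p + 1)) ∧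
      i ∉ exec (P.map lift ++ κ :: Y) (u ++ k :: v) := by
    rcases hk with rfl | rfl
    · exact ⟨_, b2.ne', Or.inr rfl, hlE⟩
    · exact ⟨_, b2.ne, Or.inl rfl, hκE⟩
  have hg : ∀ j, (j = κ ∨ j = lift (p + 1)) → gapIdx (κ :: Y) j = p + 1 := by
    rintro j (rfl | rfl)
    · exact hκZ
    · exact (he _).2
  have hiu : i ∉ exec (P.map lift ++ κ :: Y) u := by
    rw [exec_append, exec_cons, mem_exec_of_notMem fun h => hv i h hi, mem_toggle] at hiE
    tauto
  obtain ⟨w', g1, g2, g3⟩ := exists_shorter_coarse_run (gapIdx_mono (κ :: Y)) he.surjective ndP hw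
    ((hg i hi).trans (hg k hk).symm) hik hiu
  have cP : coarse (gapIdx (κ :: Y)) (P.map lift ++ κ :: Y) = P :=
    he.coarse_append (fun _ h => h) fun i hi hi' => absurd hi hi'
  have cQ : coarse (gapIdx (κ :: Y)) (Q.map lift ++ Y) = Q :=
    he.coarse_append (fun _ h => List.mem_cons_of_mem _ h) fun i hi hi' => by
      rcases List.mem_cons.1 hi with rfl | hi
      · rwa [hκZ]
      · exact absurd hi hi'
  have e3 := phi_coarse_congr (gapIdx_mono (κ :: Y)) he.surjective ndE ndQ' eE
  rw [cQ] at e3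
  rw [cP] at g1 g2
  rw [← g2, hf] at e3
  calc ln n f ≤ w'.length := ln_le_of_run hP g1 e3
    _ < _ := g3
    _ = ln n ((x (gapIdx Q (p + 1)))⁻¹ * f) := by rw [← hlen, ← hwc, length_letters]

/-! ### The two sides of an open gap -/

theorem filter_toggle (p : ℕ → Bool) (l : List ℕ) (k : ℕ) :
    (toggle l k).filter p = if p k then toggle (l.filter p) k else l.filter p := by
  unfold toggle
  by_cases hk : k ∈ l <;> by_cases hp : p k
  · simp only [hk, hp, if_true, List.mem_filter, and_self, List.filter_filter, Bool.and_comm]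
  · simp only [hk, hp, if_true, List.filter_filter]
    apply List.filter_congr
    intro a ha
    by_cases hak : a = k
    · simp [hak, hp]
    · simp [hak]
  · simp [hk, hp]
  · simp [hk, hp]

theorem filter_exec (p : ℕ → Bool) (l w : List ℕ) :
    (exec l w).filter p = exec (l.filter p) (w.filter p) := by
  induction w generalizing l with
  | nil => rfl
  | cons k w ih =>
    rw [exec_cons, ih, filter_toggle]
    by_cases hp : p k
    · rw [if_pos hp, List.filter_cons_of_pos hp, exec_cons]
    · rw [if_neg hp, List.filter_cons_of_neg hp]

/-- The gaps to the left of `c`. -/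
def leftPart (c : ℕ) (l : List ℕ) : List ℕ := l.filter (· < c)

/-- The gap `c` and the gaps to its right. -/
def rightPart (c : ℕ) (l : List ℕ) : List ℕ := l.filter (c ≤ ·)

section Sides

variable {c : ℕ}

theorem mem_leftPart {l : List ℕ} {k : ℕ} : k ∈ leftPart c l ↔ k ∈ l ∧ k < c := by
  simp [leftPart]

theorem mem_rightPart {l : List ℕ} {k : ℕ} : k ∈ rightPart c l ↔ k ∈ l ∧ c ≤ k := by
  simp [rightPart]

theorem leftPart_exec (l w : List ℕ) :
    leftPart c (exec l w) = exec (leftPart c l) (leftPart c w) := filter_exec _ _ _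

theorem rightPart_exec (l w : List ℕ) :
    rightPart c (exec l w) = exec (rightPart c l) (rightPart c w) := filter_exec _ _ _

theorem leftPart_eq_self {w : List ℕ} (h : ∀ k ∈ w, k < c) : leftPart c w = w := by
  unfold leftPart
  rw [List.filter_eq_self]
  simpa using h

theorem rightPart_eq_nil {w : List ℕ} (h : ∀ k ∈ w, k < c) : rightPart c w = [] := by
  unfold rightPart
  rw [List.filter_eq_nil_iff]
  simpa using h

theorem leftPart_rightPart (w : List ℕ) : leftPart c (rightPart c w) = [] := by
  unfold leftPart
  rw [List.filter_eq_nil_iff]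
  intro a ha
  simpa using (mem_rightPart.1 ha).2

theorem rightPart_rightPart (w : List ℕ) : rightPart c (rightPart c w) = rightPart c w := by
  simp [rightPart]

theorem length_leftPart_add (w : List ℕ) :
    (leftPart c w).length + (rightPart c w).length = w.length := by
  induction w with
  | nil => rfl
  | cons k w ih =>
    unfold leftPart rightPart at *
    by_cases h : k < c
    · rw [List.filter_cons_of_pos (by simpa using h),
        List.filter_cons_of_neg (by simpa using h)]
      simp only [List.length_cons]
      omega
    · rw [List.filter_cons_of_neg (by simpa using h),
        List.filter_cons_of_pos (by simpa using h)]
      simp only [List.length_cons]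
      omega

theorem gapIdx_leftPart (l : List ℕ) {k : ℕ} (hk : k ≤ c) :
    gapIdx (leftPart c l) k = gapIdx l k :=
  gapIdx_congr fun u hu => by
    rw [mem_leftPart]
    exact ⟨fun h => h.1, fun h => ⟨h, by omega⟩⟩

theorem exposed_leftPart {l : List ℕ} {k : ℕ} (h : Exposed l k) : Exposed (leftPart c l) k := by
  intro a ha
  obtain ⟨u, hu, hau⟩ := h a (ha.trans List.filter_sublist)
  exact ⟨u, fun h => hu (mem_leftPart.1 h).1, hau⟩

theorem exposed_of_leftPart {l : List ℕ} {k : ℕ} (hk : k < c) (hc : c ∉ l)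
    (h : Exposed (leftPart c l) k) : Exposed l k := by
  intro a ha
  have hal : a ∈ l := ha.subset (by simp)
  by_cases hac : a < c
  · obtain ⟨u, hu, hau⟩ := h a (pair_sublist_filter.2 ⟨ha, by simpa using hac, by simpa using hk⟩)
    refine ⟨u, fun h' => hu (mem_leftPart.2 ⟨h', ?_⟩), hau⟩
    unfold Between at hau
    omega
  · have : a ≠ c := fun h => hc (h ▸ hal)
    exact ⟨c, hc, Or.inr ⟨hk, by omega⟩⟩

theorem run_leftPart {n : ℕ} {l w : List ℕ} (h : Run n l w) :
    Run n (leftPart c l) (leftPart c w) := by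
  induction w generalizing l with
  | nil => trivial
  | cons k w ih =>
    have ih' := ih h.2.2
    by_cases hk : k < c
    · unfold leftPart at ih' ⊢
      rw [List.filter_cons_of_pos (by simpa using hk)]
      rw [filter_toggle, if_pos (by simpa using hk)] at ih'
      refine ⟨exposed_leftPart h.1, ?_, ih'⟩
      exact (gapIdx_leftPart l hk.le).trans_le h.2.1
    · unfold leftPart at ih' ⊢
      rw [List.filter_cons_of_neg (by simpa using hk)]
      rwa [filter_toggle, if_neg (by simpa using hk)] at ih'

theorem run_of_leftPart {n : ℕ} {l w : List ℕ} (hc : c ∉ l) (hw : ∀ k ∈ w, k < c)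
    (h : Run n (leftPart c l) w) :
    Run n l w ∧ letters l w = letters (leftPart c l) w := by
  induction w generalizing l with
  | nil => exact ⟨trivial, rfl⟩
  | cons k w ih =>
    have hk := hw k (by simp)
    have e : leftPart c (toggle l k) = toggle (leftPart c l) k := by
      unfold leftPart
      rw [filter_toggle, if_pos (by simpa using hk)]
    have hg := gapIdx_leftPart l hk.le
    have hc' : c ∉ toggle l k := by
      rw [mem_toggle]
      simp [hk.ne', hc]
    obtain ⟨h1, h2⟩ := ih hc' (fun j hj => hw j (by simp [hj])) (e ▸ h.2.2)
    refine ⟨⟨exposed_of_leftPart hk hc h.1, hg ▸ h.2.1, h1⟩, ?_⟩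
    rw [letters, letters, h2, e, hg]
    simp [mem_leftPart, hk]

/-! ### Closing and opening blocks of gaps -/

theorem run_close {n : ℕ} {l v : List ℕ} (h : (v.reverse ++ l).Nodup)
    (hn : ∀ j ∈ v, gapIdx l j ≤ n) : Run n l v ∧ exec l v = v.reverse ++ l := by
  induction v generalizing l with
  | nil => exact ⟨trivial, rfl⟩
  | cons k v ih =>
    rw [List.reverse_cons, List.append_assoc, List.singleton_append] at h ⊢
    have hk : k ∉ l := (List.nodup_cons.1 (List.Nodup.of_append_right h)).1
    obtain ⟨h1, h2⟩ := ih h fun j hj =>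
      (gapIdx_anti (List.subset_cons_self _ _) j).trans (hn j (by simp [hj]))
    rw [exec_cons, toggle_of_notMem hk]
    exact ⟨⟨exposed_of_notMem hk, hn k (by simp), by rwa [toggle_of_notMem hk]⟩, h2⟩

theorem run_open {n : ℕ} {l v : List ℕ} (h : (v ++ l).Nodup) (hn : ∀ j ∈ v, gapIdx l j ≤ n) :
    Run n (v ++ l) v ∧ exec (v ++ l) v = l := by
  induction v with
  | nil => exact ⟨trivial, rfl⟩
  | cons k v ih =>
    rw [List.cons_append] at h ⊢
    have e : toggle (k :: (v ++ l)) k = v ++ l := by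
      rw [toggle_of_mem (by simp), List.filter_cons_of_neg (by simp),
        filter_ne_of_notMem (List.nodup_cons.1 h).1]
    obtain ⟨h1, h2⟩ := ih (List.nodup_cons.1 h).2 fun j hj => hn j (by simp [hj])
    rw [exec_cons, e]
    refine ⟨⟨exposed_head _ h, ?_, by rwa [e]⟩, h2⟩
    refine (gapIdx_anti ?_ k).trans (hn k (by simp))
    intro a ha
    simp [ha]

theorem phi_glue {l l' : List ℕ} (hl : l.Nodup) (hl' : l'.Nodup) (hc : c ∉ l) (hc' : c ∉ l')
    (hL : leftPart c l = leftPart c l') (hR : rightPart c l = rightPart c l') :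
    phi l = phi l' := by
  have key : ∀ m : List ℕ, m.Nodup → c ∉ m → phi (rightPart c m) =
      wordVal (letters (leftPart c m) (leftPart c m)) * phi m := by
    intro m hm hcm
    have hlt : ∀ k ∈ leftPart c m, k < c := fun k hk => (mem_leftPart.1 hk).2
    have hr := run_open (l := []) (v := leftPart c m) (n := c) (by
      rw [List.append_nil]
      exact hm.filter _)
      fun j hj => by
        have := hlt j hj
        have h2 : gapIdx [] j = j := by simp [gapIdx]
        omega
    rw [List.append_nil] at hr
    obtain ⟨h1, h2⟩ := run_of_leftPart hcm hlt hr.1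
    rw [← h2, ← phi_exec hm h1]
    congr 1
    have e1 : leftPart c (exec m (leftPart c m)) = [] := by
      rw [leftPart_exec, leftPart_eq_self hlt, hr.2]
    have e2 : rightPart c (exec m (leftPart c m)) = rightPart c m := by
      rw [rightPart_exec, rightPart_eq_nil hlt]
      rfl
    rw [← e2]
    unfold rightPart
    rw [List.filter_eq_self]
    intro a ha
    by_contra hac
    have : a ∈ leftPart c (exec m (leftPart c m)) := mem_leftPart.2 ⟨ha, by simpa using hac⟩
    simp [e1] at this
  have h1 := key l hl hc
  have h2 := key l' hl' hc'
  rw [hL, hR, h2] at h1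
  exact (mul_left_cancel h1).symm

/-! ### Moving the right-hand part of a path -/

theorem mem_iff_of_rightPart_eq {l l' : List ℕ} (h : rightPart c l = rightPart c l') {k : ℕ}
    (hk : c ≤ k) : k ∈ l ↔ k ∈ l' := by
  have h1 := mem_rightPart (c := c) (l := l) (k := k)
  have h2 := mem_rightPart (c := c) (l := l') (k := k)
  rw [h] at h1
  tauto

theorem pair_iff_of_rightPart_eq {l l' : List ℕ} (h : rightPart c l = rightPart c l') {a k : ℕ}
    (ha : c ≤ a) (hk : c ≤ k) (hp : [a, k] <+ l') : [a, k] <+ l := by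
  have : [a, k] <+ rightPart c l' :=
    pair_sublist_filter.2 ⟨hp, by simpa using ha, by simpa using hk⟩
  rw [← h] at this
  exact this.trans List.filter_sublist

theorem gapIdx_le_of_rightPart_eq {l l' : List ℕ} (h : rightPart c l = rightPart c l')
    (hg : gapIdx l' c ≤ gapIdx l c) {k : ℕ} (hk : c ≤ k) : gapIdx l' k ≤ gapIdx l k := by
  induction k, hk using Nat.le_induction with
  | base => exact hg
  | succ k hk ih =>
    rw [gapIdx_succ, gapIdx_succ]
    simp only [mem_iff_of_rightPart_eq h hk]
    omega

/-- No gap right of `c` was closed before a gap on its left unless `c` separates or covers it. -/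
def RightFirst (c : ℕ) (l : List ℕ) : Prop :=
  ∀ a k, a < c → c ≤ k → [a, k] <+ l → k ≠ c ∧ (c ∈ l → [c, k] <+ l)

theorem RightFirst.toggle {l : List ℕ} (h : RightFirst c l) {k : ℕ} (hk : c ≤ k) :
    RightFirst c (toggle l k) := by
  intro a j ha hj hp
  by_cases hkl : k ∈ l
  · rw [toggle_of_mem hkl] at hp ⊢
    rw [pair_sublist_filter] at hp
    obtain ⟨h1, h2⟩ := h a j ha hj hp.1
    refine ⟨h1, fun h3 => ?_⟩
    rw [List.mem_filter] at h3
    exact pair_sublist_filter.2 ⟨h2 h3.1, h3.2, hp.2.2⟩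
  · rw [toggle_of_notMem hkl] at hp ⊢
    rw [pair_sublist_cons] at hp
    rcases hp with hp | ⟨rfl, -⟩
    · obtain ⟨h1, h2⟩ := h a j ha hj hp
      refine ⟨h1, fun h3 => ?_⟩
      rw [pair_sublist_cons]
      rcases List.mem_cons.1 h3 with h3 | h3
      · exact Or.inr ⟨h3, hp.subset (by simp)⟩
      · exact Or.inl (h2 h3)
    · omega

theorem exposed_of_rightPart_eq {l l' : List ℕ} (h : rightPart c l = rightPart c l') {k : ℕ}
    (hk : c ≤ k) (ht : Exposed l k) (hf : RightFirst c l') : Exposed l' k := by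
  have key : ∀ a, c ≤ a → [a, k] <+ l' → ∃ u, u ∉ l' ∧ Between a k u ∧ c ≤ u := by
    intro a ha hp
    obtain ⟨u, hu, hau⟩ := ht a (pair_iff_of_rightPart_eq h ha hk hp)
    have hcu : c ≤ u := by
      unfold Between at hau
      omega
    exact ⟨u, fun h' => hu ((mem_iff_of_rightPart_eq h hcu).2 h'), hau, hcu⟩
  intro a hp
  by_cases ha : c ≤ a
  · obtain ⟨u, h1, h2, -⟩ := key a ha hp
    exact ⟨u, h1, h2⟩
  · obtain ⟨hkc, hp'⟩ := hf a k (by omega) hk hp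
    by_cases hc : c ∈ l'
    · obtain ⟨u, h1, h2, h3⟩ := key c le_rfl (hp' hc)
      refine ⟨u, h1, ?_⟩
      unfold Between at *
      omega
    · exact ⟨c, hc, Or.inl ⟨by omega, by omega⟩⟩

theorem run_rightPart {n : ℕ} {l l' w : List ℕ} (h : Run n l w)
    (hR : rightPart c l = rightPart c l') (hf : RightFirst c l')
    (hg : ∀ u v, w = u ++ v → gapIdx l' c ≤ gapIdx (exec l u) c) :
    Run n l' (rightPart c w) := by
  induction w generalizing l l' with
  | nil => trivial
  | cons k w ih =>
    have hg0 : gapIdx l' c ≤ gapIdx l c := hg [] (k :: w) rfl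
    by_cases hk : c ≤ k
    · have e : rightPart c (k :: w) = k :: rightPart c w := by
        unfold rightPart
        rw [List.filter_cons_of_pos (by simpa using hk)]
      rw [e]
      refine ⟨exposed_of_rightPart_eq hR hk h.1 hf,
        (gapIdx_le_of_rightPart_eq hR hg0 hk).trans h.2.1, ih h.2.2 ?_ (hf.toggle hk) ?_⟩
      · unfold rightPart at hR ⊢
        rw [filter_toggle, filter_toggle, hR]
      · intro u v huv
        have e1 : gapIdx (toggle l' k) c = gapIdx l' c := gapIdx_congr fun u hu => by
          rw [mem_toggle]
          simp [(show u ≠ k by omega)]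
        rw [e1]
        exact hg (k :: u) v (by rw [huv]; rfl)
    · have e : rightPart c (k :: w) = rightPart c w := by
        unfold rightPart
        rw [List.filter_cons_of_neg (by simpa using hk)]
      rw [e]
      refine ih h.2.2 ?_ hf ?_
      · rw [← hR]
        unfold rightPart
        rw [filter_toggle, if_neg (by simpa using hk)]
      · intro u v huv
        exact hg (k :: u) v (by rw [huv]; rfl)

end Sides

/-! ### Deleting the closing of a gap from a path -/

theorem notMem_of_blocked {n s b : ℕ} {l w : List ℕ} (h : Run n l w) (hp : [s, b] <+ l)
    (hI : ∀ u, Between s b u → u ∈ l ∧ u ∉ w) (hs : s ∉ w) : b ∉ w := by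
  induction w generalizing l with
  | nil => simp
  | cons k w ih =>
    simp only [List.mem_cons, not_or] at hs hI ⊢
    have hkb : b ≠ k := by
      rintro rfl
      obtain ⟨u, hu, hsu⟩ := h.1 s hp
      exact hu (hI u hsu).1
    refine ⟨hkb, ih h.2.2 ?_ (fun u hu => ?_) hs.2⟩
    · exact pair_exec (w := [k]) hp (by simpa using hs.1) (by simpa using hkb)
    · obtain ⟨h1, h2, h3⟩ := hI u hu
      exact ⟨mem_toggle.2 (Or.inr ⟨h2, h1⟩), h3⟩

theorem exec_filter_ne {k : ℕ} (l : List ℕ) {w : List ℕ} (hw : k ∉ w) :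
    exec (l.filter (· ≠ k)) w = (exec l w).filter (· ≠ k) := by
  rw [filter_exec, filter_ne_of_notMem hw]

theorem run_filter_ne {n k : ℕ} {l w : List ℕ} (hw : ∀ j ∈ w, j < k) (h : Run n l w) :
    Run n (l.filter (· ≠ k)) w := by
  induction w generalizing l with
  | nil => trivial
  | cons j w ih =>
    have hj := hw j (by simp)
    have ih' := ih (fun i hi => hw i (by simp [hi])) h.2.2
    rw [filter_toggle, if_pos (by simpa using hj.ne)] at ih'
    refine ⟨fun a ha => ?_, ?_, ih'⟩
    · obtain ⟨u, hu, hau⟩ := h.1 a (ha.trans List.filter_sublist)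
      exact ⟨u, fun h' => hu (List.mem_filter.1 h').1, hau⟩
    · rw [gapIdx_congr (l' := l) fun u hu => by simp [(show u ≠ k by omega)]]
      exact h.2.1

theorem exists_run_delete {n c s k : ℕ} {l w : List ℕ}
    (hs : ∀ a ∈ l, a ≠ s → [s, a] <+ l) (hsw : s ∉ w) (hw : ∀ j ∈ w, j < c) (h : Run n l w)
    (hk : k ∈ exec l w) (hks : k < s) (hsc : s < c)
    (hI : ∀ u, k < u → u < c → u ∈ exec l w) (ht : Exposed (exec l w) k) :
    ∃ w', w' ⊆ w ∧ Run n l w' ∧ exec l w' = toggle (exec l w) k ∧ w'.length + 1 = w.length := by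
  have hnp : ∀ j, k < j → j < c → ¬ [j, k] <+ exec l w := by
    intro j h1 h2 hp
    obtain ⟨u, hu, hju⟩ := ht j hp
    refine hu (hI u ?_ ?_) <;> unfold Between at hju <;> omega
  have hkw : k ∈ w := by
    by_contra hkw
    have hkl := (mem_exec_of_notMem hkw).1 hk
    exact hnp s hks hsc (pair_exec (hs k hkl hks.ne) hsw hkw)
  obtain ⟨u, k', v, rfl, rfl, hv⟩ := exists_last (p := (· = k)) ⟨k, hkw, rfl⟩
  have hkv : k' ∉ v := fun h' => hv _ h' rfl
  rw [run_append] at h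
  obtain ⟨h1, -, -, h2⟩ := h
  have hkA : k' ∉ exec l u := by
    rw [exec_append, exec_cons, mem_exec_of_notMem hkv, mem_toggle] at hk
    tauto
  have hvlt : ∀ j ∈ v, j < k' := by
    by_contra hc
    push Not at hc
    obtain ⟨j, hj, hjk⟩ := hc
    obtain ⟨v₁, i, v₂, rfl, hi, hv₂⟩ := exists_last (p := fun j => k' ≤ j) ⟨j, hj, hjk⟩
    have hik : i ≠ k' := fun e => hkv (by simp [e])
    have hic : i < c := hw i (by simp)
    have hi2 : i ∉ v₂ := fun h' => hv₂ i h' hi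
    have hk1 : k' ∉ v₁ := fun h' => hkv (by simp [h'])
    have hk2 : k' ∉ v₂ := fun h' => hkv (by simp [h'])
    have hiE := hI i (by omega) hic
    refine hnp i (by omega) hic ?_
    rw [exec_append, exec_cons, exec_append, exec_cons] at hiE hk ⊢
    rw [mem_exec_of_notMem hi2, mem_toggle] at hiE
    rw [mem_exec_of_notMem hk2, mem_toggle] at hk
    apply pair_exec _ hi2 hk2
    rw [toggle_of_notMem (by tauto), pair_sublist_cons]
    right
    refine ⟨rfl, ?_⟩
    tauto
  rw [toggle_of_notMem hkA] at h2
  have e : (k' :: exec l u).filter (· ≠ k') = exec l u := by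
    rw [List.filter_cons_of_neg (by simp), filter_ne_of_notMem hkA]
  have h3 := run_filter_ne hvlt h2
  rw [e] at h3
  refine ⟨u ++ v, ?_, run_append.2 ⟨h1, h3⟩, ?_, by simp [add_assoc]⟩
  · intro a ha
    simp only [List.mem_append, List.mem_cons] at ha ⊢
    tauto
  · rw [toggle_of_mem hk, exec_append, exec_append, exec_cons, toggle_of_notMem hkA,
      ← exec_filter_ne _ hkv, e]

/-- The gaps of `v` are successively opened from the forest `l`, all the gaps between them and
`c` being closed at that moment. -/
def Peels (c : ℕ) : List ℕ → List ℕ → Prop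
  | _, [] => True
  | l, k :: v => k ∈ l ∧ k < c ∧ (∀ u, k < u → u < c → u ∈ l) ∧ Exposed l k ∧
      Peels c (toggle l k) v

theorem Peels.lt {c : ℕ} {l v : List ℕ} (h : Peels c l v) : ∀ k ∈ v, k < c := by
  induction v generalizing l with
  | nil => simp
  | cons k v ih =>
    simp only [List.mem_cons, forall_eq_or_imp]
    exact ⟨h.2.1, ih h.2.2.2.2⟩

theorem Peels.not_mem_of_notMem {c : ℕ} {l v : List ℕ} (h : Peels c l v) {k : ℕ} (hk : k ∉ l) :
    k ∉ exec l v := by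
  induction v generalizing l with
  | nil => exact hk
  | cons j v ih =>
    refine ih h.2.2.2.2 ?_
    rw [mem_toggle]
    have := h.1
    tauto

theorem Peels.notMem {c : ℕ} {l v : List ℕ} (h : Peels c l v) : ∀ k ∈ v, k ∉ exec l v := by
  induction v generalizing l with
  | nil => simp
  | cons j v ih =>
    simp only [List.mem_cons, forall_eq_or_imp]
    refine ⟨h.2.2.2.2.not_mem_of_notMem ?_, ih h.2.2.2.2⟩
    rw [mem_toggle]
    have := h.1
    tauto

theorem Peels.leftPart {c : ℕ} {l v : List ℕ} (h : Peels c l v) : Peels c (leftPart c l) v := by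
  induction v generalizing l with
  | nil => trivial
  | cons k v ih =>
    obtain ⟨h1, h2, h3, h4, h5⟩ := h
    refine ⟨mem_leftPart.2 ⟨h1, h2⟩, h2, fun u hu hu' => mem_leftPart.2 ⟨h3 u hu hu', hu'⟩,
      exposed_leftPart h4, ?_⟩
    have := ih h5
    unfold _root_.leftPart at this ⊢
    rwa [filter_toggle, if_pos (by simpa using h2)] at this

theorem exists_run_peel {n c s : ℕ} {l w v : List ℕ}
    (hs : ∀ a ∈ l, a ≠ s → [s, a] <+ l) (hsw : s ∉ w) (hw : ∀ j ∈ w, j < c) (h : Run n l w)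
    (hsc : s < c) (hv : ∀ k ∈ v, k < s) (hp : Peels c (exec l w) v) :
    ∃ w', w' ⊆ w ∧ Run n l w' ∧ exec l w' = exec (exec l w) v ∧
      w'.length + v.length = w.length := by
  induction v generalizing w with
  | nil => exact ⟨w, fun _ h => h, h, rfl, rfl⟩
  | cons k v ih =>
    obtain ⟨h1, -, h3, h4, h5⟩ := hp
    obtain ⟨w₁, a1, a2, a3, a4⟩ :=
      exists_run_delete hs hsw hw h h1 (hv k (by simp)) hsc h3 h4
    rw [← a3] at h5
    obtain ⟨w₂, b1, b2, b3, b4⟩ := ih (fun h' => hsw (a1 h')) (fun j hj => hw j (a1 hj)) a2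
      (fun j hj => hv j (by simp [hj])) h5
    refine ⟨w₂, fun _ h => a1 (b1 h), b2, by rw [b3, a3, exec_cons], ?_⟩
    rw [List.length_cons]
    omega

theorem peels_of_letters {N c i m : ℕ} {l v : List ℕ} (h : Run N l v)
    (hv : letters l v = (List.range' i m).map (·, true)) (hc : c ∉ exec l v)
    (hg : gapIdx (exec l v) c = i + m) : Peels c l v ∧ gapIdx l c = i ∧ c ∉ l := by
  induction v generalizing l i m with
  | nil =>
    rcases m with _ | m
    · exact ⟨trivial, hg, hc⟩
    · simp [letters, List.range'_succ] at hv
  | cons k v ih =>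
    rcases m with _ | m
    · simp [letters] at hv
    rw [List.range'_succ, List.map_cons, letters, List.cons.injEq, Prod.mk.injEq,
      decide_eq_true_eq] at hv
    obtain ⟨⟨hki, hk⟩, hv⟩ := hv
    obtain ⟨h1, h2, h3⟩ := ih h.2.2 hv hc (by rw [exec_cons] at hg; omega)
    have hkt : k ∉ toggle l k := by simp [mem_toggle, hk]
    have hkc : k < c := by
      by_contra hkc
      have := gapIdx_mono (toggle l k) (not_lt.1 hkc)
      rw [gapIdx_toggle_self] at this
      omega
    have hcl : c ∉ l := by
      rw [mem_toggle] at h3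
      have : c ≠ k := hkc.ne'
      tauto
    have hgc : gapIdx l c = i := by
      have := gapIdx_cons (k := c) hkt
      rw [if_pos hkc, gapIdx_congr (l := k :: toggle l k) (l' := l)] at this
      · omega
      · intro u _
        rw [List.mem_cons, mem_toggle]
        by_cases hu : u = k
        · simp [hu, hk]
        · simp [hu]
    refine ⟨⟨hk, hkc, fun u hu hu' => ?_, h.1, h1⟩, hgc, hcl⟩
    by_contra hul
    have e1 := gapIdx_lt hu' hul
    have e2 := gapIdx_mono l hu.le
    omega

/-- A path through a forest closing all gaps left of `c` can be shortened. -/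
theorem exists_run_cut {n c : ℕ} {l w v : List ℕ} (hw : ∀ k ∈ w ++ v, k < c)
    (h : Run n l (w ++ v)) (hf : ∀ u < c, u ∈ exec l w) (h1 : ∃ u < c, u ∉ l)
    (h2 : ∃ u < c, u ∉ exec l (w ++ v)) :
    ∃ w', w' ⊆ w ++ v ∧ Run n l w' ∧ exec l w' = exec l (w ++ v) ∧
      w'.length + 2 = (w ++ v).length := by
  rcases List.eq_nil_or_concat w with rfl | ⟨w₀, r, rfl⟩
  · obtain ⟨u, hu, hul⟩ := h1
    exact absurd (hf u hu) hul
  rw [List.concat_eq_append] at *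
  rcases v with _ | ⟨k, v⟩
  · obtain ⟨u, hu, hul⟩ := h2
    rw [List.append_nil] at hul
    exact absurd (hf u hu) hul
  have er : exec l (w₀ ++ [r]) = toggle (exec l w₀) r := by
    rw [exec_append]
    rfl
  rw [run_append, run_append] at h
  rw [er] at h hf
  have hr : r ∉ exec l w₀ := by
    have := hf r (hw r (by simp))
    rw [mem_toggle] at this
    tauto
  rw [toggle_of_notMem hr] at h hf
  obtain ⟨⟨g1, -⟩, g2, -, g3⟩ := h
  have hkr : k = r := by
    by_contra hkr
    have hkm := hf k (hw k (by simp))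
    obtain ⟨u, hu, hku⟩ := g2 r (pair_sublist_cons.2 (Or.inr ⟨rfl, by simpa [hkr] using hkm⟩))
    refine hu (hf u ?_)
    have := hw k (by simp)
    have := hw r (by simp)
    unfold Between at hku
    omega
  subst hkr
  have e : toggle (k :: exec l w₀) k = exec l w₀ := by
    rw [toggle_of_mem (by simp), List.filter_cons_of_neg (by simp), filter_ne_of_notMem hr]
  rw [e] at g3
  refine ⟨w₀ ++ v, ?_, run_append.2 ⟨g1, g3⟩, ?_, ?_⟩
  · intro a ha
    simp only [List.mem_append, List.mem_cons] at ha ⊢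
    simp
    tauto
  · rw [exec_append, exec_append, er, toggle_of_notMem hr, exec_cons, e]
  · simp only [List.length_append, List.length_cons, List.length_nil]
    omega

/-! ### Rerouting a path -/

theorem exists_run_reroute {n c : ℕ} {l l' v w z : List ℕ} (hl : l.Nodup) (hl' : l'.Nodup)
    (hc : c ∉ l) (hcw : c ∉ exec l w) (hc' : c ∉ l') (hw : Run n l w)
    (hR : rightPart c (exec l w) = rightPart c l') (hz : ∀ k ∈ z, k < c)
    (hzr : Run n (leftPart c l) z) (hze : exec (leftPart c l) z = leftPart c l')
    (hv : v.Nodup) (hvc : ∀ k ∈ v, k < c ∧ k ∉ l) (hn : gapIdx l c ≤ n)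
    (hg : ∀ a b, w = a ++ b → gapIdx (v.reverse ++ l) c ≤ gapIdx (exec l a) c) :
    ∃ w', Run n l w' ∧ phi (exec l w') = phi l' ∧
      w'.length = 2 * v.length + (rightPart c w).length + z.length := by
  have hvg : ∀ j ∈ v, gapIdx l j ≤ n := fun j hj => (gapIdx_mono l (hvc j hj).1.le).trans hn
  have hvl : (v.reverse ++ l).Nodup := by
    rw [List.nodup_append']
    refine ⟨List.nodup_reverse.2 hv, hl, fun k hk => (hvc k (List.mem_reverse.1 hk)).2⟩
  have hvlt : ∀ k ∈ v.reverse, k < c := fun k hk => (hvc k (List.mem_reverse.1 hk)).1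
  obtain ⟨h1, h2⟩ := run_close hvl hvg
  have hc2 : c ∉ v.reverse ++ l := by
    rw [List.mem_append, not_or]
    exact ⟨fun h => (hvlt c h).false, hc⟩
  have hR2 : rightPart c l = rightPart c (v.reverse ++ l) := by
    have := rightPart_eq_nil hvlt
    unfold rightPart at this ⊢
    rw [List.filter_append, this, List.nil_append]
  have hf : RightFirst c (v.reverse ++ l) := by
    intro a k _ _ hp
    have : k ∈ v.reverse ++ l := hp.subset (by simp)
    exact ⟨fun e => hc2 (e ▸ this), fun h => absurd h hc2⟩
  have h3 := run_rightPart hw hR2 hf hg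
  have eL : leftPart c (exec (v.reverse ++ l) (rightPart c w)) = v.reverse ++ leftPart c l := by
    rw [leftPart_exec, leftPart_rightPart]
    have := leftPart_eq_self hvlt
    unfold leftPart at this ⊢
    rw [List.filter_append, this]
    rfl
  have eR : rightPart c (exec (v.reverse ++ l) (rightPart c w)) = rightPart c (exec l w) := by
    rw [rightPart_exec, rightPart_rightPart, ← hR2, rightPart_exec]
  have hc3 : c ∉ exec (v.reverse ++ l) (rightPart c w) := by
    rwa [mem_iff_of_rightPart_eq eR le_rfl]
  have hvL : (v.reverse ++ leftPart c l).Nodup :=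
    hvl.sublist (List.filter_sublist.append_left _)
  obtain ⟨h4, h5⟩ := run_open (n := n) hvL fun j hj => by
    rw [gapIdx_leftPart l (hvlt j hj).le]
    exact hvg j (List.mem_reverse.1 hj)
  have hlt : ∀ k ∈ v.reverse ++ z, k < c := by
    intro k hk
    rcases List.mem_append.1 hk with hk | hk
    exacts [hvlt k hk, hz k hk]
  obtain ⟨h6, -⟩ := run_of_leftPart (n := n) hc3 hlt (by
    rw [eL, run_append, h5]
    exact ⟨h4, hzr⟩)
  have e : exec l (v ++ (rightPart c w ++ (v.reverse ++ z))) =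
      exec (exec (v.reverse ++ l) (rightPart c w)) (v.reverse ++ z) := by
    rw [exec_append, h2, exec_append]
  have eR' : rightPart c (exec (exec (v.reverse ++ l) (rightPart c w)) (v.reverse ++ z)) =
      rightPart c l' := by
    rw [rightPart_exec, eR, rightPart_eq_nil hlt]
    exact hR
  refine ⟨v ++ (rightPart c w ++ (v.reverse ++ z)), ?_, ?_, ?_⟩
  · rw [run_append, h2, run_append]
    exact ⟨h1, h3, h6⟩
  · rw [e]
    refine phi_glue (nodup_exec (nodup_exec hvl _) _) hl' ?_ hc' ?_ eR'
    · rwa [mem_iff_of_rightPart_eq eR' le_rfl]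
    · rw [leftPart_exec, eL, leftPart_eq_self hlt, exec_append, h5, hze]
  · simp only [List.length_append, List.length_reverse]
    omega

theorem exists_open_gaps (l : List ℕ) (c : ℕ) :
    ∃ v : List ℕ, v.Nodup ∧ (∀ k, k ∈ v ↔ k < c ∧ k ∉ l) ∧ v.length = gapIdx l c := by
  refine ⟨((Finset.range c).filter (· ∉ l)).toList, Finset.nodup_toList _, ?_, ?_⟩
  · simp
  · rw [Finset.length_toList]
    rfl

theorem mem_of_gapIdx_eq_zero {l : List ℕ} {c : ℕ} (h : gapIdx l c = 0) {u : ℕ} (hu : u < c) :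
    u ∈ l := by
  by_contra hul
  have := gapIdx_lt hu hul
  omega

/-- Shortening a path that ends by opening all gaps of `v`, starting from a state `l` in which the
gap `s` was closed last and belongs to a block of closed gaps from `b` to `c`. -/
theorem exists_run_shorter {n b c s : ℕ} {l w v : List ℕ} (hl : l.Nodup) (hw : Run n l w)
    (hs : ∀ a ∈ l, a ≠ s → [s, a] <+ l) (hsw : s ∉ w) (hsc : s < c) (hbs : b < s)
    (hv : ∀ k ∈ v, k ≤ b) (hp : Peels c (exec l w) v) (hvn : v.length + 1 = 2 * n)
    (hb : b ∉ l) (hc : c ∉ l) (hcw : c ∉ exec l w) (hn : gapIdx l c ≤ n)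
    (hE : gapIdx (exec l w) c = 1) :
    ∃ w', Run n l w' ∧ phi (exec l w') = phi (exec (exec l w) v) ∧ w'.length < w.length := by
  have hvlt : ∀ k ∈ v, k < c := hp.lt
  have hnd : (exec (exec l w) v).Nodup := nodup_exec (nodup_exec hl _) _
  have hcQ : c ∉ exec (exec l w) v := hp.not_mem_of_notMem hcw
  have hR : rightPart c (exec l w) = rightPart c (exec (exec l w) v) := by
    rw [rightPart_exec (exec l w), rightPart_eq_nil hvlt]
    rfl
  have hsL : ∀ a ∈ leftPart c l, a ≠ s → [s, a] <+ leftPart c l := by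
    intro a ha has
    obtain ⟨h1, h2⟩ := mem_leftPart.1 ha
    exact pair_sublist_filter.2 ⟨hs a h1 has, by simpa using hsc, by simpa using h2⟩
  have hwL : ∀ k ∈ leftPart c w, k ∈ w ∧ k < c := fun k hk => mem_leftPart.1 hk
  have hlen := length_leftPart_add (c := c) w
  have hpeel : ∀ y, y ⊆ leftPart c w → Run n (leftPart c l) y →
      exec (leftPart c l) y = leftPart c (exec l w) →
      ∃ z, (∀ k ∈ z, k < c) ∧ Run n (leftPart c l) z ∧
        exec (leftPart c l) z = leftPart c (exec (exec l w) v) ∧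
        z.length + v.length = y.length := by
    intro y hy hyr hye
    obtain ⟨z, h1, h2, h3, h4⟩ := exists_run_peel hsL (fun h => hsw (hwL s (hy h)).1)
      (fun k hk => (hwL k (hy hk)).2) hyr hsc (fun k hk => (hv k hk).trans_lt hbs)
      (hye ▸ hp.leftPart)
    refine ⟨z, fun k hk => (hwL k (hy (h1 hk))).2, h2, ?_, h4⟩
    rw [h3, hye, leftPart_exec (exec l w), leftPart_eq_self hvlt]
  obtain ⟨o, ho, hom, hol⟩ := exists_open_gaps l c
  by_cases hA : ∃ p q, w = p ++ q ∧ gapIdx (exec l p) c = 0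
  · obtain ⟨p, q, rfl, hpq⟩ := hA
    have eapp : leftPart c (p ++ q) = leftPart c p ++ leftPart c q := List.filter_append ..
    have hrL := run_leftPart (c := c) hw
    have heL := leftPart_exec (c := c) l (p ++ q)
    rw [eapp] at hrL heL hwL hpeel hlen
    obtain ⟨u, hu, huE⟩ : ∃ u < c, u ∉ exec l (p ++ q) := by
      by_contra! hall
      have := gapIdx_le_of_closed (a := 0) (b := c) fun u _ hu => hall u hu
      rw [gapIdx_zero] at this
      omega
    obtain ⟨y, h1, h2, h3, h4⟩ := exists_run_cut (fun k hk => (hwL k hk).2) hrL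
      (fun u hu => by
        rw [← leftPart_exec]
        exact mem_leftPart.2 ⟨mem_of_gapIdx_eq_zero hpq hu, hu⟩)
      ⟨b, by omega, fun h => hb (mem_leftPart.1 h).1⟩
      ⟨u, hu, fun h => huE (mem_leftPart.1 (heL ▸ h)).1⟩
    obtain ⟨z, g1, g2, g3, g4⟩ := hpeel y h1 h2 (h3.trans heL.symm)
    obtain ⟨w', k1, k2, k3⟩ := exists_run_reroute hl hnd hc hcw hcQ hw hR g1 g2 g3 ho
      (fun k hk => (hom k).1 hk) hn fun a _ _ => by
        have := gapIdx_le_of_closed (l := o.reverse ++ l) (a := 0) (b := c) fun u _ hu => by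
          by_cases hul : u ∈ l
          · simp [hul]
          · simp [(hom u).2 ⟨hu, hul⟩]
        rw [gapIdx_zero] at this
        omega
    exact ⟨w', k1, k2, by omega⟩
  · push Not at hA
    obtain ⟨z, g1, g2, g3, g4⟩ := hpeel _ (fun _ h => h) (run_leftPart hw)
      (leftPart_exec l w).symm
    have hbo : b ∈ o := (hom b).2 ⟨by omega, hb⟩
    have hlo := List.length_erase_of_mem hbo
    have hpo := List.length_pos_of_mem hbo
    obtain ⟨w', k1, k2, k3⟩ := exists_run_reroute hl hnd hc hcw hcQ hw hR g1 g2 g3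
      (ho.erase b) (fun k hk => (hom k).1 (List.mem_of_mem_erase hk)) hn fun a a' ha => by
        refine le_trans ?_ (Nat.one_le_iff_ne_zero.2 (hA a a' ha))
        refine Finset.card_le_one_iff_subset_singleton.2 ⟨b, fun u hu => ?_⟩
        rw [Finset.mem_filter, Finset.mem_range, List.mem_append, not_or,
          List.mem_reverse, ho.mem_erase_iff, hom] at hu
        rw [Finset.mem_singleton]
        tauto
    exact ⟨w', k1, k2, by omega⟩

/-! ### The main theorem -/

theorem wordVal_staircase (m : ℕ) :
    wordVal ((List.range' 1 m).map (·, true)) = (staircase m)⁻¹ := by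
  induction m with
  | zero => simp [wordVal, staircase]
  | succ m ih =>
    rw [List.range'_1_concat, List.map_append, wordVal_append, ih, staircase, mul_inv_rev]
    simp [wordVal, letterVal, add_comm]

theorem exists_run_of_closed_block {n b c : ℕ} {P γ μ : List ℕ} (hP : P.Nodup)
    (hγ : Run n P γ) (ht : ∀ k ∈ P, k ∈ γ ++ μ) {N : ℕ} (hμr : Run N (exec P γ) μ)
    (hnN : n ≤ N) (hp : Peels c (exec P γ) μ) (hμ : μ.length + 1 = 2 * n)
    (hcE : c ∉ exec P γ) (hE : gapIdx (exec P γ) c = 1) (hbc : b + 1 < c)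
    (hbQ : b ∉ exec (exec P γ) μ)
    (hI : ∀ u, b < u → u < c → u ∈ exec (exec P γ) μ) :
    ∃ w, Run n P w ∧ phi (exec P w) = phi (exec (exec P γ) μ) ∧ w.length < γ.length := by
  have hIμ : ∀ u, b < u → u < c → u ∉ μ := fun u h1 h2 h => hp.notMem u h (hI u h1 h2)
  have hμb : ∀ k ∈ μ, k ≤ b := by
    intro k hk
    by_contra hkb
    exact hIμ k (by omega) (hp.lt k hk) hk
  have hbμ : b ∈ μ := by
    by_contra hb
    rw [mem_exec_of_notMem hb] at hbQ
    rcases μ with _ | ⟨k, μ⟩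
    · rw [List.length_nil] at hμ
      omega
    · have h1 := hμb k (by simp)
      have h2 : b ≠ k := fun e => hb (by simp [e])
      exact hbQ (hp.2.2.1 b (by omega) (by omega))
  have hIE : ∀ u, b < u → u < c → u ∈ exec P γ := fun u h1 h2 =>
    (mem_exec_of_notMem (hIμ u h1 h2)).1 (hI u h1 h2)
  have hbγ : b + 1 ∈ γ := by
    by_cases hbP : b + 1 ∈ P
    · rcases List.mem_append.1 (ht _ hbP) with h | h
      exacts [h, absurd h (hIμ _ (by omega) hbc)]
    · refine mem_of_mem_exec_ne (l := P) fun h => hbP (h.1 (hIE _ (by omega) hbc))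
  obtain ⟨γ₀, s, γ₁, rfl, ⟨hbs, hsc⟩, hlast⟩ :=
    exists_last (p := fun u => b < u ∧ u < c) ⟨b + 1, hbγ, by omega, hbc⟩
  have hIγ : ∀ u, b < u → u < c → u ∉ γ₁ := fun u h1 h2 h => hlast u h ⟨h1, h2⟩
  rw [run_append] at hγ
  obtain ⟨hγ₀, -, hsn, hγ₁⟩ := hγ
  simp only [exec_append, exec_cons] at *
  have hIS : ∀ u, b < u → u < c → u ∈ toggle (exec P γ₀) s := fun u h1 h2 =>
    (mem_exec_of_notMem (hIγ u h1 h2)).1 (hIE u h1 h2)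
  have hsT : s ∉ exec P γ₀ := by
    have := hIS s hbs hsc
    rw [mem_toggle] at this
    tauto
  have hTnd : (toggle (exec P γ₀) s).Nodup := nodup_toggle (nodup_exec hP _) _
  have hn : gapIdx (toggle (exec P γ₀) s) c ≤ n := by
    refine (gapIdx_le_of_closed (a := s) fun u h1 h2 => hIS u (by omega) h2).trans ?_
    rwa [gapIdx_toggle_self]
  have hs : ∀ a ∈ toggle (exec P γ₀) s, a ≠ s → [s, a] <+ toggle (exec P γ₀) s := by
    rw [toggle_of_notMem hsT]
    intro a ha has
    exact pair_sublist_cons.2 (Or.inr ⟨rfl, by simpa [has] using ha⟩)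
  have hsγ : s ∉ γ₁ := hIγ s hbs hsc
  have hrun : Run N (toggle (exec P γ₀) s) (γ₁ ++ μ) :=
    run_append.2 ⟨run_of_letters_le hγ₁ fun p hp => (letters_le hγ₁ p hp).trans hnN, hμr⟩
  have hbS : b ∉ toggle (exec P γ₀) s := by
    intro hb
    refine notMem_of_blocked hrun (hs b hb hbs.ne) ?_ ?_ (List.mem_append_right _ hbμ)
    · intro u hu
      have h1 : b < u := by unfold Between at hu; omega
      have h2 : u < c := by unfold Between at hu; omega
      exact ⟨hIS u h1 h2, by simp [hIγ u h1 h2, hIμ u h1 h2]⟩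
    · simp [hsγ, hIμ s hbs hsc]
  have hcS : c ∉ toggle (exec P γ₀) s := by
    intro hc
    refine hcE ((mem_exec_of_notMem (notMem_of_blocked hγ₁ (hs c hc hsc.ne') ?_ hsγ)).2 hc)
    intro u hu
    have h1 : b < u := by unfold Between at hu; omega
    have h2 : u < c := by unfold Between at hu; omega
    exact ⟨hIS u h1 h2, hIγ u h1 h2⟩
  obtain ⟨w, h1, h2, h3⟩ :=
    exists_run_shorter hTnd hγ₁ hs hsγ hsc hbs hμb hp hμ hbS hcS hcE hn hE
  refine ⟨γ₀ ++ s :: w, run_append.2 ⟨hγ₀, exposed_of_notMem hsT, hsn, h1⟩, ?_, ?_⟩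
  · rw [exec_append, exec_cons, h2]
  · simp only [List.length_append, List.length_cons]
    omega

theorem exists_lengthening {n : ℕ} (hn : 1 ≤ n) (f : ThompsonF) :
    ln n f < ln n ((x (2 * n))⁻¹ * f) ∨ ln n f < ln n (staircase (2 * n - 1) * f) := by
  obtain ⟨c₀, hc₀, hlen, hval⟩ := exists_minimal_word hn (staircase (2 * n - 1) * f)
  obtain ⟨P, w, hP, hw, hlet, ht⟩ := exists_tight_run (n := max n (2 * n - 1))
    (c := c₀ ++ (List.range' 1 (2 * n - 1)).map (·, true)) (by
      intro p hp
      rcases List.mem_append.1 hp with hp | hp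
      · exact (hc₀ p hp).trans (le_max_left _ _)
      · obtain ⟨i, hi, rfl⟩ := List.mem_map.1 hp
        rw [List.mem_range'_1] at hi
        exact le_trans (by omega) (le_max_right _ _))
  have hphi := phi_exec hP hw
  rw [hlet, wordVal_append, wordVal_staircase, hval, inv_mul_cancel_left] at hphi
  have hwlen := length_letters P w
  obtain ⟨γ, μ, rfl, hγl⟩ : ∃ γ μ, w = γ ++ μ ∧ γ.length = c₀.length :=
    ⟨w.take c₀.length, w.drop c₀.length, (List.take_append_drop ..).symm, by
      rw [List.length_take]
      rw [hlet, List.length_append] at hwlen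
      omega⟩
  rw [letters_append] at hlet
  obtain ⟨hγ, hμ⟩ := List.append_inj hlet (by rw [length_letters, hγl])
  obtain ⟨hr₁, hr₂⟩ := run_append.1 hw
  rw [exec_append] at hphi
  set Q := exec (exec P γ) μ with hQ
  have hQnd : Q.Nodup := nodup_exec (nodup_exec hP _) _
  obtain ⟨b, hbQ, hb⟩ := exists_gap Q (2 * n - 1)
  obtain ⟨c, hcQ, hc⟩ := exists_gap Q (2 * n)
  by_cases hb1 : b + 1 ∈ Q
  · right
    obtain ⟨hp, hE, hcE⟩ := peels_of_letters (c := c) hr₂ hμ hcQ (by rw [← hQ]; omega)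
    have hbc : b < c := by
      by_contra h
      have := gapIdx_mono Q (not_lt.1 h)
      omega
    have hbc' : b + 1 ≠ c := fun e => hcQ (e ▸ hb1)
    obtain ⟨w, h1, h2, h3⟩ := exists_run_of_closed_block (b := b) hP
      (run_of_letters_le hr₁ (hγ ▸ hc₀)) ht hr₂ (le_max_left _ _) hp
      (by rw [← length_letters (exec P γ) μ, hμ, List.length_map, List.length_range']; omega)
      hcE hE (by omega) hbQ fun u h1 h2 => by
        by_contra hu
        have e1 := gapIdx_lt h1 hbQ
        have e2 : gapIdx Q u + 1 ≤ gapIdx Q c := gapIdx_lt h2 hu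
        omega
    have := ln_le_of_run hP h1 (h2.trans hphi)
    omega
  · left
    have := ln_lt_of_adjacent_open hn hP hQnd hphi hbQ hb1
    rwa [gapIdx_succ, if_neg hbQ, hb, Nat.sub_add_cancel (by omega)] at this

theorem no_deep_pockets (n : ℕ) (hn : 1 ≤ n) (g : ThompsonF) :
    ∃ h : ThompsonF, dn n g h ≤ max (4 * n - 3) (2 * n + 1) ∧ ln n g < ln n h := by
  have key : ∀ t : ThompsonF, ln n t ≤ max (4 * n - 3) (2 * n + 1) →
      ln n g⁻¹ < ln n (t * g⁻¹) →
      ∃ h : ThompsonF, dn n g h ≤ max (4 * n - 3) (2 * n + 1) ∧ ln n g < ln n h := by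
    intro t ht hlt
    refine ⟨g * t⁻¹, ?_, ?_⟩
    · rwa [dn, inv_mul_cancel_left, ln_inv hn]
    · rwa [ln_inv hn, ← ln_inv hn (t * g⁻¹), mul_inv_rev, inv_inv] at hlt
  rcases exists_lengthening hn g⁻¹ with h | h
  · refine key _ ?_ h
    rw [ln_inv hn]
    exact (ln_x_two_mul_le hn).trans (le_max_right _ _)
  · exact key _ ((ln_staircase_le hn).trans (le_max_left _ _)) h
end

section
/- Fix n ≥ 1 and let α = x_{2n−1}⁻¹ x_{2n−2}⁻¹ ⋯ x_2⁻¹ x_1⁻¹ ∈ F. For every g ∈ F, either there exists i with 0 ≤ i ≤ 2n such that l_n(g x_i) > l_n(g), or l_n(g α) > l_n(g). -/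
namespace ThompsonF

/-! ### Generators, shifts and parity -/

theorem x_mul_x {i j : ℕ} (h : i < j) : x j * x i = x i * x (j + 1) := by
  have hr : (PresentedGroup.mk thompsonRels)
      ((FreeGroup.of i)⁻¹ * FreeGroup.of j * FreeGroup.of i * (FreeGroup.of (j + 1))⁻¹) = 1 :=
    PresentedGroup.one_of_mem ⟨i, j, h, rfl⟩
  have hr' : (x i)⁻¹ * x j * x i * (x (j + 1))⁻¹ = 1 := by
    simpa [x, PresentedGroup.of] using hr
  have := mul_inv_eq_one.mp hr'
  rw [← this]
  group

/-- A map on the generators that respects the relations of `F` extends to `F`. -/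
theorem exists_lift {G : Type*} [Group G] (f : ℕ → G)
    (hf : ∀ i j, i < j → f j * f i = f i * f (j + 1)) :
    ∃ φ : ThompsonF →* G, ∀ i, φ (x i) = f i := by
  have h : ∀ r ∈ thompsonRels, FreeGroup.lift f r = 1 := by
    rintro _ ⟨i, j, hij, rfl⟩
    have h : (f i)⁻¹ * (f j * f i) * (f (j + 1))⁻¹ = 1 := by rw [hf i j hij]; group
    simpa [mul_assoc] using h
  exact ⟨PresentedGroup.toGroup h, fun i => PresentedGroup.toGroup.of h⟩

theorem exists_shift (k : ℕ) : ∃ φ : ThompsonF →* ThompsonF, ∀ i, φ (x i) = x (i + k) :=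
  exists_lift (fun i => x (i + k)) fun i j h => by
    rw [x_mul_x (by omega : i + k < j + k), show j + k + 1 = j + 1 + k by omega]

/-- The endomorphism of `F` sending `x_i` to `x_{i+k}`. -/
noncomputable def shift (k : ℕ) : ThompsonF →* ThompsonF := (exists_shift k).choose

@[simp] theorem shift_x (k i : ℕ) : shift k (x i) = x (i + k) := (exists_shift k).choose_spec i

theorem hom_ext {G : Type*} [Group G] {φ ψ : ThompsonF →* G} (h : ∀ i, φ (x i) = ψ (x i)) :
    φ = ψ :=
  PresentedGroup.ext h

theorem shift_mul_x {i k : ℕ} (h : i < k) (z : ThompsonF) :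
    shift k z * x i = x i * shift (k + 1) z := by
  have : (MulAut.conj (x i)⁻¹).toMonoidHom.comp (shift k) = shift (k + 1) := hom_ext fun j => by
    simp [mul_assoc, x_mul_x (by omega : i < j + k), ← add_assoc]
  rw [← this]
  simp [mul_assoc]

theorem shift_mul_x_inv {i k : ℕ} (h : i < k) (z : ThompsonF) :
    shift (k + 1) z * (x i)⁻¹ = (x i)⁻¹ * shift k z := by
  rw [mul_inv_eq_iff_eq_mul, mul_assoc, shift_mul_x h, inv_mul_cancel_left]

theorem shift_mul_x_zero_pow {k : ℕ} (hk : 0 < k) (m : ℕ) (z : ThompsonF) :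
    shift k z * x 0 ^ m = x 0 ^ m * shift (k + m) z := by
  induction m with
  | zero => simp
  | succ m ih =>
    rw [pow_succ, ← mul_assoc, ih, mul_assoc, shift_mul_x (by omega), mul_assoc, add_assoc]

/-! ### Words -/

/-- The generator or inverse generator named by a letter. -/
def letter (y : ℕ × Bool) : ThompsonF := if y.2 then x y.1 else (x y.1)⁻¹

/-- `g` is a product of `k` letters from `X_n`. -/
def IsWord (n : ℕ) (g : ThompsonF) (k : ℕ) : Prop :=
  ∃ l : List (ℕ × Bool), l.length = k ∧ (∀ y ∈ l, y.1 ≤ n) ∧ (l.map letter).prod = g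

theorem IsWord.mul {n : ℕ} {g h : ThompsonF} {k m : ℕ} (hg : IsWord n g k) (hh : IsWord n h m) :
    IsWord n (g * h) (k + m) := by
  obtain ⟨l, rfl, hl, rfl⟩ := hg
  obtain ⟨l', rfl, hl', rfl⟩ := hh
  refine ⟨l ++ l', by simp, ?_, by simp⟩
  intro y hy
  rcases List.mem_append.mp hy with hy | hy
  exacts [hl y hy, hl' y hy]

theorem isWord_one (n : ℕ) : IsWord n 1 0 := ⟨[], rfl, by simp, rfl⟩

theorem isWord_letter {n : ℕ} {y : ℕ × Bool} (h : y.1 ≤ n) : IsWord n (letter y) 1 :=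
  ⟨[y], rfl, by simpa using h, by simp⟩

theorem isWord_x {n i : ℕ} (h : i ≤ n) : IsWord n (x i) 1 := isWord_letter (y := (i, true)) h

theorem isWord_x_inv {n i : ℕ} (h : i ≤ n) : IsWord n (x i)⁻¹ 1 :=
  isWord_letter (y := (i, false)) h

theorem isWord_x_zero_pow (n m : ℕ) : IsWord n (x 0 ^ m) m := by
  induction m with
  | zero => exact isWord_one n
  | succ m ih => exact pow_succ (x 0) m ▸ ih.mul (isWord_x (Nat.zero_le n))

theorem isWord_x_zero_pow_inv (n m : ℕ) : IsWord n (x 0 ^ m)⁻¹ m := by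
  induction m with
  | zero => simpa using isWord_one n
  | succ m ih =>
    rw [pow_succ', mul_inv_rev]
    exact ih.mul (isWord_x_inv (Nat.zero_le n))

theorem exists_isWord {n : ℕ} (hn : 1 ≤ n) (g : ThompsonF) : ∃ k, IsWord n g k := by
  have key : ∀ i, ∃ k, IsWord n (x i) k ∧ IsWord n (x i)⁻¹ k := by
    intro i
    induction i with
    | zero => exact ⟨1, isWord_x (by omega), isWord_x_inv (by omega)⟩
    | succ i ih =>
      rcases Nat.eq_zero_or_pos i with rfl | hi
      · exact ⟨1, isWord_x (by omega), isWord_x_inv (by omega)⟩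
      obtain ⟨k, h, h'⟩ := ih
      have e : x (i + 1) = (x 0)⁻¹ * x i * x 0 := by rw [mul_assoc, x_mul_x hi]; group
      have e' : (x (i + 1))⁻¹ = (x 0)⁻¹ * (x i)⁻¹ * x 0 := by rw [e]; group
      exact ⟨1 + k + 1, e ▸ ((isWord_x_inv (Nat.zero_le n)).mul h).mul (isWord_x (Nat.zero_le n)),
        e' ▸ ((isWord_x_inv (Nat.zero_le n)).mul h').mul (isWord_x (Nat.zero_le n))⟩
  obtain ⟨w, rfl⟩ := PresentedGroup.mk_surjective _ g
  induction w using FreeGroup.induction_on with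
  | C1 => exact ⟨0, isWord_one n⟩
  | of i => obtain ⟨k, h, -⟩ := key i; exact ⟨k, h⟩
  | inv_of i _ => obtain ⟨k, -, h⟩ := key i; exact ⟨k, h⟩
  | mul a b ha hb =>
    obtain ⟨k, hk⟩ := ha
    obtain ⟨m, hm⟩ := hb
    exact ⟨k + m, by simpa using hk.mul hm⟩

theorem isWord_iff {n : ℕ} {g : ThompsonF} {k : ℕ} : IsWord n g k ↔
    ∃ l : List ThompsonF, l.length = k ∧ (∀ a ∈ l, a ∈ Xset n ∨ a⁻¹ ∈ Xset n) ∧ l.prod = g := by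
  constructor
  · rintro ⟨l, rfl, hl, rfl⟩
    refine ⟨l.map letter, by simp, ?_, rfl⟩
    intro a ha
    obtain ⟨⟨i, s⟩, hy, rfl⟩ := List.mem_map.mp ha
    cases s
    · exact Or.inr ⟨i, hl _ hy, by simp [letter]⟩
    · exact Or.inl ⟨i, hl _ hy, by simp [letter]⟩
  · rintro ⟨l, rfl, hl, rfl⟩
    induction l with
    | nil => exact isWord_one n
    | cons a l ih =>
      have h := ih fun b hb => hl b (List.mem_cons_of_mem a hb)
      rw [List.prod_cons, List.length_cons, add_comm]
      refine IsWord.mul ?_ h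
      rcases hl a List.mem_cons_self with ⟨i, hi, rfl⟩ | ⟨i, hi, hai⟩
      · exact isWord_x hi
      · rw [← inv_inv a, hai]
        exact isWord_x_inv hi

theorem ln_le {n : ℕ} {g : ThompsonF} {k : ℕ} (h : IsWord n g k) : ln n g ≤ k :=
  Nat.sInf_le (isWord_iff.mp h)

theorem isWord_ln {n : ℕ} (hn : 1 ≤ n) (g : ThompsonF) : IsWord n g (ln n g) := by
  obtain ⟨k, hk⟩ := exists_isWord hn g
  have hne : {m | ∃ l : List ThompsonF, l.length = m ∧
      (∀ a ∈ l, a ∈ Xset n ∨ a⁻¹ ∈ Xset n) ∧ l.prod = g}.Nonempty := ⟨k, isWord_iff.mp hk⟩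
  exact isWord_iff.mpr (Nat.sInf_mem hne)

theorem exists_sign : ∃ φ : ThompsonF →* ℤˣ, ∀ i, φ (x i) = -1 :=
  exists_lift (fun _ => -1) fun _ _ _ => rfl

theorem IsWord.map_sign {φ : ThompsonF →* ℤˣ} (hφ : ∀ i, φ (x i) = -1) {n : ℕ} {g : ThompsonF}
    {k : ℕ} (h : IsWord n g k) : φ g = (-1) ^ k := by
  obtain ⟨l, rfl, -, rfl⟩ := h
  induction l with
  | nil => simp
  | cons y l ih =>
    have : φ (letter y) = -1 := by
      unfold letter
      split_ifs <;> simp [hφ]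
    simp [this, ih, pow_succ']

theorem ln_mul_x_ne {n : ℕ} (hn : 1 ≤ n) (g : ThompsonF) (i : ℕ) : ln n g ≠ ln n (g * x i) := by
  obtain ⟨φ, hφ⟩ := exists_sign
  intro h
  have h₁ := (isWord_ln hn g).map_sign hφ
  have h₂ := (isWord_ln hn (g * x i)).map_sign hφ
  rw [← h, ← h₁, map_mul, hφ] at h₂
  exact absurd (mul_eq_left.mp h₂) (by decide)

/-! ### Tracking a node of the infinite binary forest

Right multiplication by `x_i` splits the `i`-th tree of the bottom forest of an element of `F` into
its two halves, and right multiplication by `x_i⁻¹` joins the trees `i` and `i + 1`. A node of the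
forest is given by the index of its tree together with a path (`true` for right turns). -/

/-- Splitting tree `i` moves the first node to the second one. The node consisting of the whole
tree `i` is destroyed by the splitting. -/
inductive Splits : ℕ → ℕ × List Bool → ℕ × List Bool → Prop
  | lt {i a : ℕ} {w : List Bool} (h : a < i) : Splits i (a, w) (a, w)
  | leftHalf {i : ℕ} {w : List Bool} : Splits i (i, false :: w) (i, w)
  | rightHalf {i : ℕ} {w : List Bool} : Splits i (i, true :: w) (i + 1, w)
  | gt {i a : ℕ} {w : List Bool} (h : i < a) : Splits i (a, w) (a + 1, w)

/-- A letter moves the first node to the second one. -/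
def Step (a : ℕ × List Bool) (y : ℕ × Bool) (b : ℕ × List Bool) : Prop :=
  if y.2 then Splits y.1 a b else Splits y.1 b a

/-- A word moves the first node to the second one, keeping it intact throughout. -/
inductive Path : ℕ × List Bool → List (ℕ × Bool) → ℕ × List Bool → Prop
  | nil (a : ℕ × List Bool) : Path a [] a
  | cons {a b c : ℕ × List Bool} {y : ℕ × Bool} {l : List (ℕ × Bool)} (h : Step a y b)
      (h' : Path b l c) : Path a (y :: l) c

theorem Path.append {a b c : ℕ × List Bool} {l l' : List (ℕ × Bool)} (h : Path a l b)
    (h' : Path b l' c) : Path a (l ++ l') c := by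
  induction h with
  | nil => exact h'
  | cons hs _ ih => exact .cons hs (ih h')

theorem exists_step_or (y : ℕ × Bool) (b : ℕ × List Bool) :
    (∃ a, Step a y b) ∨ (y.2 = false ∧ b = (y.1, [])) := by
  obtain ⟨i, s⟩ := y
  obtain ⟨k, w⟩ := b
  cases s
  · rcases lt_trichotomy k i with h | rfl | h
    · exact Or.inl ⟨_, Splits.lt h⟩
    · match w with
      | [] => exact Or.inr ⟨rfl, rfl⟩
      | false :: w => exact Or.inl ⟨_, Splits.leftHalf⟩
      | true :: w => exact Or.inl ⟨_, Splits.rightHalf⟩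
    · exact Or.inl ⟨_, Splits.gt h⟩
  · rcases lt_trichotomy k i with h | rfl | h
    · exact Or.inl ⟨_, Splits.lt h⟩
    · exact Or.inl ⟨_, Splits.leftHalf⟩
    · obtain ⟨d, rfl⟩ := Nat.exists_eq_add_of_lt h
      cases d with
      | zero => exact Or.inl ⟨_, Splits.rightHalf⟩
      | succ d => exact Or.inl ⟨_, Splits.gt (by omega : i < i + d + 1)⟩

/-- Either a node can be traced back through the whole word, or it is created by one of the
letters. -/
theorem exists_path_or (l : List (ℕ × Bool)) (c : ℕ × List Bool) :
    (∃ a, Path a l c) ∨ ∃ l₁ i l₂, l = l₁ ++ (i, false) :: l₂ ∧ Path (i, []) l₂ c := by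
  induction l with
  | nil => exact Or.inl ⟨c, .nil c⟩
  | cons y l ih =>
    rcases ih with ⟨b, hb⟩ | ⟨l₁, i, l₂, rfl, h⟩
    · rcases exists_step_or y b with ⟨a, ha⟩ | ⟨h, rfl⟩
      · exact Or.inl ⟨a, .cons ha hb⟩
      · exact Or.inr ⟨[], y.1, l, by simp [← h], hb⟩
    · exact Or.inr ⟨y :: l₁, i, l₂, rfl, h⟩

/-- The product of the generators that successively split off the node `w` of tree `a`. -/
def spine : ℕ → List Bool → ThompsonF
  | _, [] => 1
  | a, false :: w => x a * spine a w
  | a, true :: w => x a * spine (a + 1) w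

theorem spine_mul_x {i a : ℕ} (h : i < a) (w : List Bool) :
    spine a w * x i = x i * spine (a + 1) w := by
  induction w generalizing a with
  | nil => simp [spine]
  | cons s w ih =>
    cases s
    · rw [spine, spine, mul_assoc, ih h, ← mul_assoc, x_mul_x h, mul_assoc]
    · rw [spine, spine, mul_assoc, ih (by omega), ← mul_assoc, x_mul_x h, mul_assoc]

theorem x_mul_spine {i a : ℕ} (h : a < i) (w : List Bool) :
    x i * spine a w = spine a w * x (i + w.length) := by
  induction w generalizing a i with
  | nil => simp [spine]
  | cons s w ih =>
    cases s
    · rw [spine, ← mul_assoc, x_mul_x h, mul_assoc, ih (by omega), mul_assoc, List.length_cons,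
        add_assoc, add_comm 1]
    · rw [spine, ← mul_assoc, x_mul_x h, mul_assoc, ih (by omega), mul_assoc, List.length_cons,
        add_assoc, add_comm 1]

theorem x_mul_x_pow {i j : ℕ} (h : i < j) (e : ℕ) : x j * x i ^ e = x i ^ e * x (j + e) := by
  induction e generalizing j with
  | zero => simp
  | succ e ih =>
    rw [pow_succ', ← mul_assoc, x_mul_x h, mul_assoc, ih (by omega), mul_assoc, add_assoc,
      add_comm 1]

theorem inv_mul_letter {i j : ℕ} {c : ThompsonF} (h : x i * c = c * x j) (s : Bool) :
    c⁻¹ * letter (i, s) = letter (j, s) * c⁻¹ := by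
  have hj : x j = c⁻¹ * x i * c := by rw [mul_assoc, h, inv_mul_cancel_left]
  cases s <;> simp [letter, hj, mul_assoc]

@[simp] theorem shift_letter (k i : ℕ) (s : Bool) :
    shift k (letter (i, s)) = letter (i + k, s) := by
  cases s <;> simp [letter]

/-- The product `g` of a word of length `len` that moves the tree `lam` to the node `a` is split
into a part `y` acting to the right of the node, a part `b` acting to its left, and the letters
that move the border between the two. The numbers of letters of these three kinds are `R`, `L` and
`M`, and the index of the tree containing the node has been at least `μ` all the time. -/
def Decomposes (n lam : ℕ) (g : ThompsonF) (len : ℕ) (a : ℕ × List Bool) : Prop :=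
  ∃ (y b : ThompsonF) (μ L R M : ℕ),
    g = shift (lam + 1) y * b * (spine a.1 a.2)⁻¹ ∧
    (∀ z, shift lam z * b = b * shift (a.1 + a.2.count true) z) ∧
    IsWord n b L ∧
    (∀ m ≤ μ, IsWord n (shift (m + 1) y * (x m ^ a.2.count false)⁻¹) R) ∧
    L + R + M = len ∧ μ ≤ lam ∧ μ ≤ a.1 ∧ a.2.count true ≤ M ∧
    (μ = 0 → a.1 = 0 ∨ a.2.count true + 2 ≤ M)

theorem decomposes_one (n lam : ℕ) : Decomposes n lam 1 0 (lam, []) :=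
  ⟨1, 1, lam, 0, 0, 0, by simp [spine], by simp, isWord_one n,
    fun m _ => by simpa using isWord_one n, rfl, le_rfl, le_rfl, by simp, fun h => Or.inl h⟩

section Step

variable {n lam len i a : ℕ} {g : ThompsonF} {w : List Bool}

theorem Decomposes.lt (h : Decomposes n lam g len (a, w)) (hi : i ≤ n) (ha : a < i) (s : Bool) :
    Decomposes n lam (g * letter (i, s)) (len + 1) (a, w) := by
  obtain ⟨y, b, μ, L, R, M, hg, hb, hL, hR, hlen, h₁, h₂, h₃, h₄⟩ := h
  obtain ⟨d, rfl⟩ := Nat.exists_eq_add_of_lt ha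
  have hw : w.count true + w.count false = w.length := List.count_true_add_count_false w
  refine ⟨y * letter (d + w.count false, s), b, μ, L, R + 1, M, ?_, hb, hL, fun m hm => ?_,
    by omega, h₁, h₂, h₃, h₄⟩
  · have e : letter (a + d + 1 + w.length, s) =
        shift (a + w.count true) (letter (d + w.count false + 1, s)) := by
      rw [shift_letter]; congr 2; omega
    rw [hg, mul_assoc, inv_mul_letter (x_mul_spine ha w), ← mul_assoc, mul_assoc _ b, e, ← hb,
      map_mul, shift_letter, shift_letter]
    simp only [mul_assoc, add_assoc, add_comm 1]
  · have e := inv_mul_letter (x_mul_x_pow (by omega : m < d + 1 + m) (w.count false)) s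
    rw [map_mul, shift_letter, mul_assoc,
      show d + w.count false + (m + 1) = d + 1 + m + w.count false by omega, ← e, ← mul_assoc]
    exact (hR m hm).mul (isWord_letter (show d + 1 + m ≤ n from by
      have : μ ≤ a := h₂
      omega))

theorem Decomposes.split_leftHalf (h : Decomposes n lam g len (a, false :: w)) (hi : a ≤ n) :
    Decomposes n lam (g * letter (a, true)) (len + 1) (a, w) := by
  obtain ⟨y, b, μ, L, R, M, hg, hb, hL, hR, hlen, h₁, h₂, h₃, h₄⟩ := h
  refine ⟨y, b, μ, L, R + 1, M, by simp [hg, spine, letter, mul_assoc], by simpa using hb, hL,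
    fun m hm => ?_, by omega, h₁, h₂, by simpa using h₃, by simpa using h₄⟩
  have e : shift (m + 1) y * (x m ^ w.count false)⁻¹ =
      shift (m + 1) y * (x m ^ (false :: w).count false)⁻¹ * x m := by
    simp [pow_succ', mul_assoc]
  rw [e]
  exact (hR m hm).mul (isWord_x ((hm.trans h₂).trans hi))

theorem Decomposes.join_leftHalf (h : Decomposes n lam g len (a, w)) (hi : a ≤ n) :
    Decomposes n lam (g * letter (a, false)) (len + 1) (a, false :: w) := by
  obtain ⟨y, b, μ, L, R, M, hg, hb, hL, hR, hlen, h₁, h₂, h₃, h₄⟩ := h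
  refine ⟨y, b, μ, L, R + 1, M, by simp [hg, spine, letter, mul_assoc], by simpa using hb, hL,
    fun m hm => ?_, by omega, h₁, h₂, by simpa using h₃, by simpa using h₄⟩
  have e : shift (m + 1) y * (x m ^ (false :: w).count false)⁻¹ =
      shift (m + 1) y * (x m ^ w.count false)⁻¹ * (x m)⁻¹ := by
    simp [pow_succ', mul_assoc]
  change IsWord n (shift (m + 1) y * (x m ^ (false :: w).count false)⁻¹) (R + 1)
  rw [e]
  exact (hR m hm).mul (isWord_x_inv ((hm.trans h₂).trans hi))

theorem Decomposes.split_rightHalf (h : Decomposes n lam g len (a, true :: w)) :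
    Decomposes n lam (g * letter (a, true)) (len + 1) (a + 1, w) := by
  obtain ⟨y, b, μ, L, R, M, hg, hb, hL, hR, hlen, h₁, h₂, h₃, h₄⟩ := h
  simp only [List.count_cons_self] at h₃ h₄ h₂
  refine ⟨y, b, μ, L, R, M + 1, by simp [hg, spine, letter, mul_assoc], ?_, hL,
    by simpa using hR, by omega, h₁, by simp only; omega, by simp only; omega, fun h => ?_⟩
  · simpa [add_assoc, add_comm 1] using hb
  · simp only; omega

theorem Decomposes.join_rightHalf (h : Decomposes n lam g len (a + 1, w)) :
    Decomposes n lam (g * letter (a, false)) (len + 1) (a, true :: w) := by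
  obtain ⟨y, b, μ, L, R, M, hg, hb, hL, hR, hlen, h₁, h₂, h₃, h₄⟩ := h
  simp only at h₃ h₄ h₂
  refine ⟨y, b, min μ a, L, R, M + 1, by simp [hg, spine, letter, mul_assoc], ?_, hL,
    fun m hm => by simpa using hR m (by omega), by omega, by omega, by simp only; omega,
    by simp only [List.count_cons_self]; omega, fun h => ?_⟩
  · simpa [add_assoc, add_comm 1] using hb
  · simp only [List.count_cons_self]; omega

theorem Decomposes.split_gt (h : Decomposes n lam g len (a, w)) (hi : i ≤ n) (ha : i < a) :
    Decomposes n lam (g * letter (i, true)) (len + 1) (a + 1, w) := by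
  obtain ⟨y, b, μ, L, R, M, hg, hb, hL, hR, hlen, h₁, h₂, h₃, h₄⟩ := h
  simp only at h₃ h₄ h₂ hb
  refine ⟨y, b * x i, μ, L + 1, R, M, ?_, fun z => ?_, hL.mul (isWord_x hi), hR, by omega, h₁,
    by simp only; omega, h₃, fun h => by simp only; omega⟩
  · have e : (spine a w)⁻¹ * x i = x i * (spine (a + 1) w)⁻¹ := by
      rw [inv_mul_eq_iff_eq_mul, ← mul_assoc, spine_mul_x ha, mul_inv_cancel_right]
    simp only [hg, letter, if_true, mul_assoc, e]
  · simp only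
    rw [← mul_assoc, hb, mul_assoc, shift_mul_x (by omega), mul_assoc, add_right_comm]

theorem Decomposes.join_gt (h : Decomposes n lam g len (a + 1, w)) (hi : i ≤ n) (ha : i < a) :
    Decomposes n lam (g * letter (i, false)) (len + 1) (a, w) := by
  obtain ⟨y, b, μ, L, R, M, hg, hb, hL, hR, hlen, h₁, h₂, h₃, h₄⟩ := h
  simp only at h₃ h₄ h₂ hb
  refine ⟨y, b * (x i)⁻¹, min μ a, L + 1, R, M, ?_, fun z => ?_, hL.mul (isWord_x_inv hi),
    fun m hm => hR m (by omega), by omega, by omega,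
    by simp only; omega, h₃, fun h => by simp only; omega⟩
  · have e : (spine (a + 1) w)⁻¹ * (x i)⁻¹ = (x i)⁻¹ * (spine a w)⁻¹ := by
      rw [← mul_inv_rev, ← mul_inv_rev, spine_mul_x ha]
    simp [hg, letter, mul_assoc, e]
  · simp only
    rw [← mul_assoc, hb, mul_assoc, add_right_comm, shift_mul_x_inv (by omega), mul_assoc]

end Step

theorem Decomposes.step {n lam len : ℕ} {g : ThompsonF} {a b : ℕ × List Bool} {y : ℕ × Bool}
    (h : Decomposes n lam g len a) (hy : y.1 ≤ n) (hs : Step a y b) :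
    Decomposes n lam (g * letter y) (len + 1) b := by
  obtain ⟨i, s⟩ := y
  cases s
  · simp only [Step, Bool.false_eq_true, if_false] at hs
    cases hs with
    | lt ha => exact h.lt hy ha false
    | leftHalf => exact h.join_leftHalf hy
    | rightHalf => exact h.join_rightHalf
    | gt ha => exact h.join_gt hy ha
  · simp only [Step, if_true] at hs
    cases hs with
    | lt ha => exact h.lt hy ha true
    | leftHalf => exact h.split_leftHalf hy
    | rightHalf => exact h.split_rightHalf
    | gt ha => exact h.split_gt hy ha

theorem Decomposes.path {n lam len : ℕ} {g : ThompsonF} {a b : ℕ × List Bool}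
    {l : List (ℕ × Bool)} (h : Decomposes n lam g len a) (hl : ∀ y ∈ l, y.1 ≤ n)
    (hp : Path a l b) : Decomposes n lam (g * (l.map letter).prod) (len + l.length) b := by
  induction hp generalizing g len with
  | nil => simpa using h
  | cons hs _ ih =>
    have := ih (h.step (hl _ List.mem_cons_self) hs) fun y hy => hl y (List.mem_cons_of_mem _ hy)
    rw [List.map_cons, List.prod_cons, ← mul_assoc, List.length_cons, add_comm (List.length _),
      ← add_assoc]
    exact this

/-- If a word for `g * (spine 1 w)⁻¹` creates the node `(1, w)`, then `g` is shorter, provided that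
`w` consists of `2n - 1` right turns. -/
theorem isWord_of_path {n i : ℕ} {l₁ l₂ : List (ℕ × Bool)}
    (hl : ∀ y ∈ l₁ ++ (i, false) :: l₂, y.1 ≤ n)
    (hp : Path (i, []) l₂ (1, List.replicate (2 * n - 1) true)) :
    ∃ k < (l₁ ++ (i, false) :: l₂).length,
      IsWord n (((l₁ ++ (i, false) :: l₂).map letter).prod *
        spine 1 (List.replicate (2 * n - 1) true)) k := by
  have hi : i ≤ n := hl (i, false) (by simp)
  have hd := (decomposes_one n i).path (fun y hy => hl y (by simp [hy])) hp
  obtain ⟨y, b, μ, L, R, M, hg, hb, hL, hR, hlen, h₁, h₂, h₃, h₄⟩ := hd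
  have hR' := hR μ le_rfl
  simp only [List.count_replicate, one_mul] at hg hR' h₂ h₃ h₄
  simp only [BEq.rfl, if_true, one_ne_zero, false_or] at h₃ h₄
  have e : shift (i + 1) y = (x 0 ^ (i - μ))⁻¹ * shift (μ + 1) y * x 0 ^ (i - μ) := by
    rw [mul_assoc, shift_mul_x_zero_pow (by omega), inv_mul_cancel_left]
    congr 2
    omega
  have h₀ : IsWord n (l₁.map letter).prod l₁.length :=
    ⟨l₁, rfl, fun y hy => hl y (by simp [hy]), rfl⟩
  have hword := ((h₀.mul (isWord_x_inv hi)).mul (((isWord_x_zero_pow_inv n (i - μ)).mul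
    (by simpa using hR')).mul (isWord_x_zero_pow n (i - μ)))).mul hL
  refine ⟨l₁.length + 1 + (i - μ + R + (i - μ)) + L, ?_, ?_⟩
  · simp only [List.length_append, List.length_cons]
    omega
  · convert hword using 1
    rw [← e, List.map_append, List.prod_append, List.map_cons, List.prod_cons, hg]
    simp [letter, mul_assoc]

/-! ### Deleting a set of leaves

The ends of every tree of the infinite binary forest are labelled by natural numbers, those in the
left half by the even numbers and those in the right half by the odd ones. A set of ends is then a
sequence of subsets of `ℕ`. Deleting a set of ends from the forest pairs of all prefixes of a word
yields a word that is at most as long. -/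

/-- The ends of a tree in its left half. -/
def lo (A : Set ℕ) : Set ℕ := {m | 2 * m ∈ A}

/-- The ends of a tree in its right half. -/
def hi (A : Set ℕ) : Set ℕ := {m | 2 * m + 1 ∈ A}

/-- The set of ends of a tree with given left and right halves. -/
def glue (A B : Set ℕ) : Set ℕ := {m | if m % 2 = 0 then m / 2 ∈ A else m / 2 ∈ B}

@[simp] theorem lo_glue (A B : Set ℕ) : lo (glue A B) = A := by
  ext m
  simp [lo, glue]

@[simp] theorem hi_glue (A B : Set ℕ) : hi (glue A B) = B := by
  ext m
  simp [hi, glue, Nat.add_mod, Nat.mul_add_div]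

@[simp] theorem glue_lo_hi (A : Set ℕ) : glue (lo A) (hi A) = A := by
  ext m
  simp only [lo, hi, glue, Set.mem_ofPred_eq]
  split_ifs with h
  · rw [show 2 * (m / 2) = m by omega]
  · rw [show 2 * (m / 2) + 1 = m by omega]

theorem eq_univ_iff_halves (A : Set ℕ) : A = Set.univ ↔ lo A = Set.univ ∧ hi A = Set.univ := by
  constructor
  · rintro rfl
    simp [lo, hi]
  · rintro ⟨h, h'⟩
    rw [← glue_lo_hi A, h, h']
    ext m
    simp [glue]

@[simp] theorem lo_empty : lo ∅ = ∅ := rfl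

@[simp] theorem hi_empty : hi ∅ = ∅ := rfl

/-- The effect on a set of ends of splitting tree `i`. -/
def splitAt (i : ℕ) (K : ℕ → Set ℕ) (k : ℕ) : Set ℕ :=
  if k < i then K k else if k = i then lo (K i) else if k = i + 1 then hi (K i) else K (k - 1)

/-- The effect on a set of ends of joining the trees `i` and `i + 1`. -/
def joinAt (i : ℕ) (K : ℕ → Set ℕ) (k : ℕ) : Set ℕ :=
  if k < i then K k else if k = i then glue (K i) (K (i + 1)) else K (k + 1)

theorem splitAt_joinAt (i : ℕ) (K : ℕ → Set ℕ) : splitAt i (joinAt i K) = K := by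
  funext k
  simp only [splitAt, joinAt]
  grind [lo_glue, hi_glue]

theorem joinAt_splitAt (i : ℕ) (K : ℕ → Set ℕ) : joinAt i (splitAt i K) = K := by
  funext k
  simp only [splitAt, joinAt]
  grind [glue_lo_hi]

theorem splitAt_splitAt {i j : ℕ} (h : i < j) (K : ℕ → Set ℕ) :
    splitAt i (splitAt j K) = splitAt (j + 1) (splitAt i K) := by
  funext k
  simp only [splitAt]
  grind

open Classical in
/-- The number of trees before tree `i` that are not deleted completely. -/
noncomputable def survivors (K : ℕ → Set ℕ) : ℕ → ℕ
  | 0 => 0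
  | i + 1 => survivors K i + if K i = Set.univ then 0 else 1

/-- Both halves of tree `i` survive the deletion. -/
def Survives (K : ℕ → Set ℕ) (i : ℕ) : Prop := lo (K i) ≠ Set.univ ∧ hi (K i) ≠ Set.univ

theorem survivors_le (K : ℕ → Set ℕ) (i : ℕ) : survivors K i ≤ i := by
  induction i with
  | zero => exact le_rfl
  | succ i ih =>
    simp only [survivors]
    split_ifs <;> omega

theorem survivors_congr {K K' : ℕ → Set ℕ} {i : ℕ} (h : ∀ k < i, K k = K' k) :
    survivors K i = survivors K' i := by
  induction i with
  | zero => rfl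
  | succ i ih => rw [survivors, survivors, ih fun k hk => h k (by omega), h i (by omega)]

theorem survivors_eq {K : ℕ → Set ℕ} (h : ∀ k, K k ≠ Set.univ) (i : ℕ) : survivors K i = i := by
  induction i with
  | zero => rfl
  | succ i ih => rw [survivors, ih, if_neg (h i)]

theorem survivors_lt {K : ℕ → Set ℕ} {i j : ℕ} (h : i < j) (hi : Survives K i) :
    survivors K i < survivors K j := by
  induction j with
  | zero => omega
  | succ j ih =>
    rw [survivors]
    rcases Nat.lt_succ_iff_lt_or_eq.mp h with h' | rfl
    · exact (ih h').trans_le (Nat.le_add_right _ _)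
    · rw [if_neg fun h => hi.1 ((eq_univ_iff_halves _).mp h).1]
      exact Nat.lt_succ_self _

open Classical in
theorem survivors_splitAt {i j : ℕ} (h : i < j) (K : ℕ → Set ℕ) :
    survivors (splitAt i K) (j + 1) = survivors K j + if Survives K i then 1 else 0 := by
  induction j with
  | zero => omega
  | succ j ih =>
    rcases Nat.lt_succ_iff_lt_or_eq.mp h with h' | rfl
    · rw [survivors, ih h', survivors, show splitAt i K (j + 1) = K j from by
        simp only [splitAt]; grind]
      omega
    · have e : survivors (splitAt i K) i = survivors K i :=
        survivors_congr fun k hk => by simp [splitAt, hk]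
      simp only [survivors, e, splitAt, Survives, eq_univ_iff_halves (K i)]
      grind

open Classical in
/-- What is left of the letter `x_i` after deleting `K`. -/
noncomputable def residue (K : ℕ → Set ℕ) (i : ℕ) : ThompsonF :=
  if Survives K i then x (survivors K i) else 1

theorem residue_mul_residue {i j : ℕ} (h : i < j) (K : ℕ → Set ℕ) :
    residue K j * residue (splitAt j K) i = residue K i * residue (splitAt i K) (j + 1) := by
  have e₁ : survivors (splitAt j K) i = survivors K i :=
    survivors_congr fun k hk => by simp [splitAt, hk.trans h]
  have e₂ : Survives (splitAt j K) i = Survives K i := by simp [Survives, splitAt, h]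
  have e₃ : Survives (splitAt i K) (j + 1) = Survives K j := by
    have : splitAt i K (j + 1) = K j := by simp only [splitAt]; grind
    simp [Survives, this]
  by_cases hi : Survives K i <;> by_cases hj : Survives K j <;>
    simp [residue, e₁, e₂, e₃, survivors_splitAt h, hi, hj]
  exact x_mul_x (survivors_lt h hi)

/-- The permutation recording how `x_i` changes a set of ends and the reduced word. -/
noncomputable def deletion (i : ℕ) : Equiv.Perm ((ℕ → Set ℕ) × ThompsonF) where
  toFun p := (splitAt i p.1, p.2 * residue p.1 i)
  invFun p := (joinAt i p.1, p.2 * (residue (joinAt i p.1) i)⁻¹)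
  left_inv p := by simp [joinAt_splitAt]
  right_inv p := by simp [splitAt_joinAt]

theorem deletion_mul_deletion {i j : ℕ} (h : i < j) :
    deletion i * deletion j = deletion (j + 1) * deletion i := by
  refine Equiv.ext fun p => ?_
  change (_, _) = (_, _)
  simp [deletion, splitAt_splitAt h, mul_assoc, residue_mul_residue h]

theorem exists_deletion_hom : ∃ φ : ThompsonF →* (Equiv.Perm ((ℕ → Set ℕ) × ThompsonF))ᵐᵒᵖ,
    ∀ i, φ (x i) = MulOpposite.op (deletion i) :=
  exists_lift _ fun i j h => by
    rw [← MulOpposite.op_mul, ← MulOpposite.op_mul, deletion_mul_deletion h]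

/-- The action of `F` on pairs of a set of ends and an element of `F`. -/
noncomputable def deletionHom : ThompsonF →* (Equiv.Perm ((ℕ → Set ℕ) × ThompsonF))ᵐᵒᵖ :=
  exists_deletion_hom.choose

theorem deletionHom_x (i : ℕ) : deletionHom (x i) = MulOpposite.op (deletion i) :=
  exists_deletion_hom.choose_spec i

theorem deletionHom_mul (g h : ThompsonF) (p : (ℕ → Set ℕ) × ThompsonF) :
    (deletionHom (g * h)).unop p = (deletionHom h).unop ((deletionHom g).unop p) := by
  simp

theorem isWord_residue {n i : ℕ} (h : i ≤ n) (K : ℕ → Set ℕ) :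
    ∃ m ≤ 1, IsWord n (residue K i) m ∧ IsWord n (residue K i)⁻¹ m := by
  have hs := (survivors_le K i).trans h
  unfold residue
  split_ifs
  · exact ⟨1, le_rfl, isWord_x hs, isWord_x_inv hs⟩
  · exact ⟨0, by omega, isWord_one n, by simpa using isWord_one n⟩

/-- Deleting a set of ends does not increase the length of a word. -/
theorem isWord_deletionHom {n k : ℕ} {g : ThompsonF} (h : IsWord n g k)
    (p : (ℕ → Set ℕ) × ThompsonF) :
    ∃ c, ∃ m ≤ k, IsWord n c m ∧ ((deletionHom g).unop p).2 = p.2 * c := by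
  obtain ⟨l, rfl, hl, rfl⟩ := h
  induction l generalizing p with
  | nil => exact ⟨1, 0, le_rfl, isWord_one n, by simp⟩
  | cons y l ih =>
    have hy : ∃ c, ∃ m ≤ 1, IsWord n c m ∧ ((deletionHom (letter y)).unop p).2 = p.2 * c := by
      obtain ⟨i, s⟩ := y
      have hi : i ≤ n := hl _ List.mem_cons_self
      cases s
      · obtain ⟨m, hm, -, h⟩ := isWord_residue hi (joinAt i p.1)
        refine ⟨_, m, hm, h, ?_⟩
        simp [letter, deletionHom_x, deletion, Equiv.Perm.inv_def]
      · obtain ⟨m, hm, h, -⟩ := isWord_residue hi p.1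
        refine ⟨_, m, hm, h, ?_⟩
        simp [letter, deletionHom_x, deletion]
    obtain ⟨c, m, hm, hc, e⟩ := hy
    obtain ⟨c', m', hm', hc', e'⟩ := ih ((deletionHom (letter y)).unop p)
      (fun z hz => hl z (List.mem_cons_of_mem y hz))
    refine ⟨c * c', m + m', by simp only [List.length_cons]; omega, hc.mul hc', ?_⟩
    rw [List.map_cons, List.prod_cons, deletionHom_mul, e', e, mul_assoc]

/-- The left half of the node `w` of a tree. -/
def halfNode : List Bool → Set ℕ
  | [] => glue Set.univ ∅
  | false :: w => glue (halfNode w) ∅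
  | true :: w => glue ∅ (halfNode w)

theorem halfNode_ne_univ (w : List Bool) : halfNode w ≠ Set.univ := by
  rw [Ne, eq_univ_iff_halves]
  rcases w with _ | ⟨_ | _, w⟩ <;> simp [halfNode, Set.empty_ne_univ]

/-- The set of ends in the left half of a node of the forest. -/
def halfNodeAt (a : ℕ × List Bool) (k : ℕ) : Set ℕ := if k = a.1 then halfNode a.2 else ∅

theorem halfNodeAt_ne_univ (a : ℕ × List Bool) (k : ℕ) : halfNodeAt a k ≠ Set.univ := by
  unfold halfNodeAt
  split_ifs
  exacts [halfNode_ne_univ _, Set.empty_ne_univ]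

theorem Splits.deletion_apply {i : ℕ} {a b : ℕ × List Bool} (h : Splits i a b) (f : ThompsonF) :
    deletion i (halfNodeAt a, f) = (halfNodeAt b, f * x i) := by
  have hsurv : Survives (halfNodeAt a) i := by
    cases h with
    | lt h => simp [Survives, halfNodeAt, h.ne', Set.empty_ne_univ]
    | leftHalf => simp [Survives, halfNodeAt, halfNode, halfNode_ne_univ, Set.empty_ne_univ]
    | rightHalf => simp [Survives, halfNodeAt, halfNode, halfNode_ne_univ, Set.empty_ne_univ]
    | gt h => simp [Survives, halfNodeAt, h.ne, Set.empty_ne_univ]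
  have hsplit : splitAt i (halfNodeAt a) = halfNodeAt b := by
    funext k
    cases h <;> simp only [splitAt, halfNodeAt, halfNode] <;>
      grind [lo_glue, hi_glue, lo_empty, hi_empty, halfNode]
  change (splitAt i (halfNodeAt a), f * residue (halfNodeAt a) i) = _
  rw [hsplit, residue, if_pos hsurv, survivors_eq (halfNodeAt_ne_univ a)]

theorem Step.deletionHom_apply {a b : ℕ × List Bool} {y : ℕ × Bool} (h : Step a y b)
    (f : ThompsonF) :
    (deletionHom (letter y)).unop (halfNodeAt a, f) = (halfNodeAt b, f * letter y) := by
  obtain ⟨i, s⟩ := y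
  cases s
  · simp only [Step, Bool.false_eq_true, if_false] at h
    have := h.deletion_apply (f * (x i)⁻¹)
    rw [inv_mul_cancel_right] at this
    simp only [letter, Bool.false_eq_true, if_false, map_inv, deletionHom_x,
      MulOpposite.unop_inv, MulOpposite.unop_op]
    rw [Equiv.Perm.inv_eq_iff_eq, this]
  · simp only [Step, if_true] at h
    simpa [letter, deletionHom_x] using h.deletion_apply f

theorem Path.deletionHom_apply {a b : ℕ × List Bool} {l : List (ℕ × Bool)} (h : Path a l b)
    (f : ThompsonF) : (deletionHom (l.map letter).prod).unop (halfNodeAt a, f) =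
      (halfNodeAt b, f * (l.map letter).prod) := by
  induction h generalizing f with
  | nil => simp
  | cons hs _ ih =>
    rw [List.map_cons, List.prod_cons, deletionHom_mul, hs.deletionHom_apply, ih, mul_assoc]

/-- If tree `i` of `g` is trivial, then `g * x_i` is longer than `g`. -/
theorem ln_lt_ln_mul_x {n i : ℕ} (hn : 1 ≤ n) {a : ℕ × List Bool} {l : List (ℕ × Bool)}
    (h : Path a l (i, [])) : ln n (l.map letter).prod < ln n ((l.map letter).prod * x i) := by
  refine lt_of_le_of_ne ?_ (ln_mul_x_ne hn _ i)
  obtain ⟨c, m, hm, hc, e⟩ := isWord_deletionHom (isWord_ln hn ((l.map letter).prod * x i))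
    (halfNodeAt a, 1)
  have hres : residue (halfNodeAt (i, [])) i = 1 :=
    if_neg fun h => h.1 (by simp [halfNodeAt, halfNode])
  rw [deletionHom_mul, h.deletionHom_apply, deletionHom_x] at e
  have : (l.map letter).prod = c := by simpa [deletion, hres] using e
  rw [← this] at hc
  exact (ln_le hc).trans hm

/-- The letters of `spine a (List.replicate m true)` carry its last node to a trivial tree. -/
theorem exists_path_spine (a m : ℕ) : ∃ l : List (ℕ × Bool),
    (l.map letter).prod = spine a (List.replicate m true) ∧
      Path (a, List.replicate m true) l (a + m, []) := by
  induction m generalizing a with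
  | zero => exact ⟨[], rfl, .nil _⟩
  | succ m ih =>
    obtain ⟨l, hl, hp⟩ := ih (a + 1)
    refine ⟨(a, true) :: l, by simp [hl, List.replicate_succ, spine, letter], ?_⟩
    rw [add_right_comm, add_assoc] at hp
    exact .cons Splits.rightHalf hp

theorem prod_range_x_inv (m : ℕ) :
    ((List.range m).map fun i => (x (m - i))⁻¹).prod = (spine 1 (List.replicate m true))⁻¹ := by
  have key : ∀ a, spine a (List.replicate m true) =
      ((List.range m).map fun i => x (a + i)).prod := by
    induction m with
    | zero => simp [spine]
    | succ m ih =>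
      intro a
      rw [List.replicate_succ, spine, ih, List.range_succ_eq_map]
      simp [Function.comp_def, add_assoc, add_comm 1]
  rw [key, List.prod_inv_reverse]
  congr 1
  refine List.ext_getElem (by simp) fun i h₁ h₂ => ?_
  simp only [List.length_map, List.length_range] at h₁
  simp
  congr 1
  omega

end ThompsonF

open ThompsonF in
theorem some_multiplication_increases_length (n : ℕ) (hn : 1 ≤ n) (g : ThompsonF) :
    (∃ i ≤ 2 * n, ln n g < ln n (g * x i)) ∨
      ln n g < ln n (g * ((List.range (2 * n - 1)).map (fun i => (x (2 * n - 1 - i))⁻¹)).prod) := by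
  rw [prod_range_x_inv]
  set p := spine 1 (List.replicate (2 * n - 1) true) with hp
  obtain ⟨l, hlen, hl, hprod⟩ := isWord_ln hn (g * p⁻¹)
  have hg : g = (l.map letter).prod * p := by rw [hprod, inv_mul_cancel_right]
  rcases exists_path_or l (1, List.replicate (2 * n - 1) true) with
    ⟨a, ha⟩ | ⟨l₁, i, l₂, rfl, h⟩
  · obtain ⟨l', hl', hp'⟩ := exists_path_spine 1 (2 * n - 1)
    have := ln_lt_ln_mul_x hn (ha.append hp')
    rw [List.map_append, List.prod_append, hl', ← hp, ← hg] at this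
    rw [show 1 + (2 * n - 1) = 2 * n by omega] at this
    exact Or.inl ⟨2 * n, le_rfl, this⟩
  · obtain ⟨k, hk, hw⟩ := isWord_of_path hl h
    rw [← hp, ← hg, hlen] at *
    exact Or.inr ((ln_le hw).trans_lt hk)
end

section
/- The element g = x_1 x_2 x_5 x_6 x_3⁻² x_2⁻¹ of Thompson's group F has word length exactly 7 with respect to the generating set X_3 = {x_0, x_1, x_2, x_3}, i.e., l_3(g) = 7; moreover g = x_3 x_1 x_2 x_3⁻² x_2⁻¹ x_3 in F. -/
/-- The list of points reachable from `a` by applying at most `k` elements of `S`. -/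
def orbitBall {G α : Type*} [SMul G α] [DecidableEq α] (S : List G) (a : α) : ℕ → List α
  | 0 => [a]
  | k + 1 => (orbitBall S a k ++ (orbitBall S a k).flatMap fun b => S.map (· • b)).dedup

theorem prod_smul_mem_orbitBall {G α : Type*} [Monoid G] [MulAction G α] [DecidableEq α]
    (S : List G) (a : α) (k : ℕ) (l : List G) (hl : l.length ≤ k) (hS : ∀ s ∈ l, s ∈ S) :
    l.prod • a ∈ orbitBall S a k := by
  induction k generalizing l with
  | zero =>
    obtain rfl : l = [] := List.length_eq_zero_iff.mp (by omega)
    simp [orbitBall]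
  | succ k ih =>
    rw [orbitBall, List.mem_dedup, List.mem_append]
    cases l with
    | nil => exact Or.inl (ih [] (by simp) (by simp))
    | cons s l =>
      refine Or.inr (List.mem_flatMap.mpr ⟨l.prod • a, ih l ?_ ?_, ?_⟩)
      · simpa using hl
      · exact fun t ht => hS t (List.mem_cons_of_mem _ ht)
      · exact List.mem_map.mpr ⟨s, hS s List.mem_cons_self, by rw [List.prod_cons, mul_smul]⟩

/-- If `g` is a product of at most `m + n` elements of the symmetric set `S`, then the ball of
radius `n` around `a` meets the ball of radius `m` around `g • a`. -/
theorem exists_mem_orbitBall_of_prod_eq {G α : Type*} [Group G] [MulAction G α] [DecidableEq α]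
    {S : List G} (hinv : ∀ s ∈ S, s⁻¹ ∈ S) (a : α) (m n : ℕ) {l : List G}
    (hl : l.length ≤ m + n) (hS : ∀ s ∈ l, s ∈ S) :
    ∃ b ∈ orbitBall S a n, b ∈ orbitBall S (l.prod • a) m := by
  refine ⟨(l.drop m).prod • a, prod_smul_mem_orbitBall S a n _ ?_ ?_, ?_⟩
  · rw [List.length_drop]
    omega
  · exact fun s hs => hS s (List.mem_of_mem_drop hs)
  · have h : (l.drop m).prod • a = ((l.take m).map (·⁻¹)).reverse.prod • l.prod • a := by
      rw [← List.prod_inv_reverse, smul_smul, ← List.prod_take_mul_prod_drop l m,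
        inv_mul_cancel_left]
    rw [h]
    refine prod_smul_mem_orbitBall S _ m _ (by simp) fun s hs => ?_
    obtain ⟨t, ht, rfl⟩ := List.mem_map.mp (List.mem_reverse.mp hs)
    exact hinv t (hS t (List.mem_of_mem_take ht))

/-- The permutation of `ℕ × ℕ` by which `x i` acts: the rows `i` and `i + 1` are interleaved
into row `i`, and the rows above are shifted down by one. -/
def interleave (i : ℕ) : Equiv.Perm (ℕ × ℕ) where
  toFun p :=
    if p.1 < i then p else if p.1 = i then (i, 2 * p.2)
    else if p.1 = i + 1 then (i, 2 * p.2 + 1) else (p.1 - 1, p.2)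
  invFun p :=
    if p.1 < i then p else if p.1 = i then (i + p.2 % 2, p.2 / 2) else (p.1 + 1, p.2)
  left_inv p := by
    obtain ⟨n, m⟩ := p
    grind
  right_inv p := by
    obtain ⟨n, m⟩ := p
    grind

theorem interleave_mul_interleave {i j : ℕ} (hij : i < j) :
    interleave j * interleave i = interleave i * interleave (j + 1) := by
  ext1 ⟨n, m⟩
  simp only [Equiv.Perm.mul_apply, interleave, Equiv.coe_fn_mk]
  grind

/-- The action of Thompson's group on `ℕ × ℕ`. -/
def thompsonPerm : ThompsonF →* Equiv.Perm (ℕ × ℕ) :=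
  PresentedGroup.toGroup (f := interleave) <| by
    rintro _ ⟨i, j, hij, rfl⟩
    simp only [map_mul, map_inv, FreeGroup.lift_apply_of]
    rw [mul_inv_eq_one, mul_assoc, interleave_mul_interleave hij, inv_mul_cancel_left]

theorem thompsonPerm_x (i : ℕ) : thompsonPerm (x i) = interleave i :=
  PresentedGroup.toGroup.of _

theorem x_mul_x {i j : ℕ} (hij : i < j) : x j * x i = x i * x (j + 1) := by
  have h := PresentedGroup.one_of_mem (rels := thompsonRels) ⟨i, j, hij, rfl⟩
  simp only [map_mul, map_inv] at h
  rw [mul_inv_eq_one, mul_assoc, inv_mul_eq_iff_eq_mul] at h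
  exact h

theorem x_inv_mul_x {i j : ℕ} (hij : i < j) : (x i)⁻¹ * x j = x (j + 1) * (x i)⁻¹ := by
  rw [inv_mul_eq_iff_eq_mul, ← mul_assoc, ← x_mul_x hij, mul_inv_cancel_right]

/-- The permutations by which `x 0, …, x n` and their inverses act. -/
def interleaveLetters (n : ℕ) : List (Equiv.Perm (ℕ × ℕ)) :=
  (List.range (n + 1)).map interleave ++ (List.range (n + 1)).map fun i => (interleave i)⁻¹

theorem inv_mem_interleaveLetters {n : ℕ} {s : Equiv.Perm (ℕ × ℕ)}
    (hs : s ∈ interleaveLetters n) : s⁻¹ ∈ interleaveLetters n := by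
  simp only [interleaveLetters, List.mem_append, List.mem_map] at hs ⊢
  rcases hs with ⟨i, hi, rfl⟩ | ⟨i, hi, rfl⟩
  · exact Or.inr ⟨i, hi, rfl⟩
  · exact Or.inl ⟨i, hi, (inv_inv _).symm⟩

theorem thompsonPerm_mem_interleaveLetters {n : ℕ} {a : ThompsonF}
    (ha : a ∈ Xset n ∨ a⁻¹ ∈ Xset n) : thompsonPerm a ∈ interleaveLetters n := by
  have key : ∀ b ∈ Xset n, thompsonPerm b ∈ interleaveLetters n := by
    rintro _ ⟨i, hi, rfl⟩
    rw [thompsonPerm_x]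
    exact List.mem_append_left _ (List.mem_map_of_mem (List.mem_range.mpr (by omega)))
  rcases ha with ha | ha
  · exact key a ha
  · simpa using inv_mem_interleaveLetters (key _ ha)

theorem disjoint_orbitBall_interleave :
    ∀ b ∈ orbitBall (interleaveLetters 3) (((2, 1), (3, 1)) : (ℕ × ℕ) × (ℕ × ℕ)) 3,
      b ∉ orbitBall (interleaveLetters 3)
        ((interleave 1 * interleave 2 * interleave 5 * interleave 6 * (interleave 3)⁻¹ *
          (interleave 3)⁻¹ * (interleave 2)⁻¹) •
            (((2, 1), (3, 1)) : (ℕ × ℕ) × (ℕ × ℕ))) 3 := by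
  decide +kernel

theorem example_length_seven :
    ln 3 (x 1 * x 2 * x 5 * x 6 * (x 3)⁻¹ * (x 3)⁻¹ * (x 2)⁻¹) = 7 ∧
      x 1 * x 2 * x 5 * x 6 * (x 3)⁻¹ * (x 3)⁻¹ * (x 2)⁻¹ =
        x 3 * x 1 * x 2 * (x 3)⁻¹ * (x 3)⁻¹ * (x 2)⁻¹ * x 3 := by
  have heq : x 1 * x 2 * x 5 * x 6 * (x 3)⁻¹ * (x 3)⁻¹ * (x 2)⁻¹ =
      x 3 * x 1 * x 2 * (x 3)⁻¹ * (x 3)⁻¹ * (x 2)⁻¹ * x 3 := by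
    symm
    calc x 3 * x 1 * x 2 * (x 3)⁻¹ * (x 3)⁻¹ * (x 2)⁻¹ * x 3
        = (x 3 * x 1) * x 2 * (x 3)⁻¹ * (x 3)⁻¹ * ((x 2)⁻¹ * x 3) := by group
      _ = x 1 * (x 4 * x 2) * (x 3)⁻¹ * ((x 3)⁻¹ * x 4) * (x 2)⁻¹ := by
          rw [x_mul_x (by norm_num), x_inv_mul_x (by norm_num)]
          group
      _ = x 1 * x 2 * x 5 * ((x 3)⁻¹ * x 5) * (x 3)⁻¹ * (x 2)⁻¹ := by
          rw [x_mul_x (by norm_num), x_inv_mul_x (by norm_num)]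
          group
      _ = x 1 * x 2 * x 5 * x 6 * (x 3)⁻¹ * (x 3)⁻¹ * (x 2)⁻¹ := by
          rw [x_inv_mul_x (by norm_num)]
          group
  refine ⟨IsLeast.csInf_eq ⟨?_, ?_⟩, heq⟩
  · have hx : ∀ i ≤ 3, x i ∈ Xset 3 := fun i hi => ⟨i, hi, rfl⟩
    refine ⟨[x 3, x 1, x 2, (x 3)⁻¹, (x 3)⁻¹, (x 2)⁻¹, x 3], rfl, ?_, ?_⟩
    · simp [hx]
    · rw [heq]
      simp [mul_assoc]
  · rintro m ⟨l, rfl, hl, hprod⟩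
    by_contra! hlt
    obtain ⟨b, hb, hb'⟩ := exists_mem_orbitBall_of_prod_eq
      (fun _ => inv_mem_interleaveLetters) (((2, 1), (3, 1)) : (ℕ × ℕ) × (ℕ × ℕ)) 3 3
      (l := l.map thompsonPerm) (by rw [List.length_map]; omega) (by
        intro s hs
        obtain ⟨a, ha, rfl⟩ := List.mem_map.mp hs
        exact thompsonPerm_mem_interleaveLetters (hl a ha))
    rw [← map_list_prod, hprod] at hb'
    simp only [map_mul, map_inv, thompsonPerm_x] at hb'
    exact disjoint_orbitBall_interleave b hb hb'
end
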